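/- arXiv:2512.06821 — 9 statements merged into one kernel-verified Lean document; each statement's English description precedes it below -/
import Mathlib

section
/- Suppose the columns p₁,…,pₙ of P are ℚ-linearly independent. Then for every continuous function F : 𝕋ⁿ → ℂ and every y ∈ 𝕋ⁿ, the averages (2T)^{-d} ∫_{[-T,T]^d} F(y + Pᵀx mod ℤⁿ) dx converge, as T → ∞, to ∫_{𝕋ⁿ} F(z) dz (the integral with respect to normalized Haar measure). -/
open MeasureTheory Filter

/-- Convergence of averages along a continuous map into a compact space only needs to be checked
on a set of continuous functions with dense span. -/
theorem tendsto_setAverage_of_span_dense {ι Ω X : Type*} [TopologicalSpace X] [CompactSpace X]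
    [MeasurableSpace X] [BorelSpace X] {μ : Measure X} [IsFiniteMeasure μ]
    [TopologicalSpace Ω] [MeasurableSpace Ω] [OpensMeasurableSpace Ω] {ν : Measure Ω}
    {s : ι → Set Ω} (hs : ∀ i, ν (s i) ≠ ⊤) {g : Ω → X} (hg : Continuous g) {l : Filter ι}
    {S : Set C(X, ℂ)} (hS : (Submodule.span ℂ S).topologicalClosure = ⊤)
    (h : ∀ f ∈ S, Tendsto (fun i => ⨍ x in s i, f (g x) ∂ν) l (nhds (∫ z, f z ∂μ)))
    (f : C(X, ℂ)) :
    Tendsto (fun i => ⨍ x in s i, f (g x) ∂ν) l (nhds (∫ z, f z ∂μ)) := by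
  have hfin (i : ι) : IsFiniteMeasure (ν.restrict (s i)) := ⟨by simpa using (hs i).lt_top⟩
  have hint (f : C(X, ℂ)) (i : ι) : Integrable (fun x => f (g x)) (ν.restrict (s i)) :=
    .of_bound (f.continuous.comp hg).aestronglyMeasurable ‖f‖
      (.of_forall fun x => f.norm_coe_le_norm _)
  have hintX (f : C(X, ℂ)) : Integrable f μ :=
    .of_bound f.continuous.aestronglyMeasurable ‖f‖ (.of_forall f.norm_coe_le_norm)
  have hcont : Continuous fun f : C(X, ℂ) => ∫ z, f z ∂μ := by
    refine (LipschitzWith.of_dist_le_mul (K := (μ.real Set.univ).toNNReal) fun a b => ?_).continuous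
    rw [dist_eq_norm, dist_eq_norm, ← integral_sub (hintX a) (hintX b), mul_comm,
      Real.coe_toNNReal _ measureReal_nonneg]
    exact norm_integral_le_of_norm_le_const (.of_forall (a - b).norm_coe_le_norm)
  have hlip (i : ι) : LipschitzWith 1 fun f : C(X, ℂ) => ⨍ x in s i, f (g x) ∂ν := by
    refine LipschitzWith.of_dist_le_mul fun a b => ?_
    rw [dist_eq_norm, dist_eq_norm, setAverage_eq, setAverage_eq, ← smul_sub,
      ← integral_sub (hint a i) (hint b i), norm_smul, norm_inv, Real.norm_of_nonneg
      measureReal_nonneg, NNReal.coe_one, one_mul]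
    refine (mul_le_mul_of_nonneg_left (norm_setIntegral_le_of_norm_le_const (C := ‖a - b‖)
      (hs i).lt_top fun x _ => (a - b).norm_coe_le_norm (g x)) (by positivity)).trans ?_
    rw [mul_left_comm]
    exact mul_le_of_le_one_right (norm_nonneg _) inv_mul_le_one
  have hequi : Equicontinuous fun i (f : C(X, ℂ)) => ⨍ x in s i, f (g x) ∂ν :=
    (LipschitzWith.uniformEquicontinuous _ 1 hlip).equicontinuous
  have hclosed := hequi.isClosed_setOfPred_tendsto (l := l) hcont
  have hspan : (Submodule.span ℂ S : Set C(X, ℂ)) ⊆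
      {f | Tendsto (fun i => ⨍ x in s i, f (g x) ∂ν) l (nhds (∫ z, f z ∂μ))} := by
    intro f hf
    induction hf using Submodule.span_induction with
    | mem f hf => exact h f hf
    | zero => simp [setAverage_eq, tendsto_const_nhds]
    | add a b _ _ ha hb =>
      refine (Tendsto.add ha hb).congr' ?_ |>.trans_eq ?_
      · refine .of_forall fun i => ?_
        simp only [setAverage_eq, ContinuousMap.add_apply]
        rw [integral_add (hint a i) (hint b i), smul_add]
      · simp only [ContinuousMap.add_apply]
        rw [integral_add (hintX a) (hintX b)]
    | smul c a _ ha =>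
      refine (Tendsto.const_smul ha c).congr' ?_ |>.trans_eq ?_
      · refine .of_forall fun i => ?_
        simp only [setAverage_eq, ContinuousMap.smul_apply]
        rw [integral_smul, smul_comm]
      · simp only [ContinuousMap.smul_apply]
        rw [integral_smul]
  have hmem : f ∈ (Submodule.span ℂ S).topologicalClosure := hS ▸ Submodule.mem_top
  exact closure_minimal hspan hclosed hmem

/-- The averages over `[-T, T]` of the character `x ↦ exp (a i x)` tend to `0` as `T → ∞`, unless
the character is trivial. -/
theorem tendsto_average_exp_mul_I (a : ℝ) :
    Tendsto (fun T : ℝ => ((2 * T : ℝ) : ℂ)⁻¹ * ∫ x in Set.Icc (-T) T,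
      Complex.exp (a * Complex.I * x)) atTop (nhds (if a = 0 then 1 else 0)) := by
  split_ifs with ha
  · refine tendsto_const_nhds.congr' ?_
    filter_upwards [eventually_gt_atTop 0] with T hT
    have : (T : ℂ) ≠ 0 := by exact_mod_cast hT.ne'
    simp [ha, Real.volume_real_Icc_of_le (show -T ≤ T by linarith)]
    field_simp
    norm_num
  · have hc : (a * Complex.I : ℂ) ≠ 0 := by simp [ha]
    refine squeeze_zero_norm' (a := fun T : ℝ => (2 * T)⁻¹ * (2 / |a|)) ?_ ?_
    · filter_upwards [eventually_gt_atTop 0] with T hT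
      rw [integral_Icc_eq_integral_Ioc, ← intervalIntegral.integral_of_le (by linarith),
        integral_exp_mul_complex hc, norm_mul, norm_inv, Complex.norm_real,
        Real.norm_of_nonneg (by positivity), norm_div]
      have hn : ‖(a * Complex.I : ℂ)‖ = |a| := by simp
      have he (x : ℝ) : ‖Complex.exp (a * Complex.I * x)‖ = 1 := by
        rw [← Complex.norm_exp_ofReal_mul_I (a * x)]; push_cast; ring_nf
      rw [hn]
      gcongr
      refine (norm_sub_le _ _).trans ?_
      rw [he, he]; norm_num
    · have : Tendsto (fun T : ℝ => (2 * T)⁻¹) atTop (nhds 0) :=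
        tendsto_inv_atTop_zero.comp (tendsto_id.const_mul_atTop two_pos)
      simpa using this.mul_const (2 / |a|)

/-- The integral over the torus of a character. -/
theorem integral_mFourier {ι : Type*} [Fintype ι] (k : ι → ℤ) :
    ∫ z : ι → AddCircle (1 : ℝ), UnitAddTorus.mFourier k z = if k = 0 then 1 else 0 := by
  split_ifs with hk
  · subst hk
    simp [UnitAddTorus.mFourier_zero, Measure.real, volume_pi, Measure.pi_univ]
  · obtain ⟨j, hj⟩ := Function.ne_iff.mp hk
    simp only [UnitAddTorus.mFourier, ContinuousMap.coe_mk]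
    rw [integral_fintype_prod_volume_eq_prod (fun i z => fourier (k i) z)]
    exact Finset.prod_eq_zero (Finset.mem_univ j)
      (integral_eq_zero_of_add_right_eq_neg (fourier_add_half_inv_index hj one_pos))

/-- A character of the torus, restricted to an orbit of the `ℝᵈ`-action, is a product of
one-variable exponentials. -/
theorem mFourier_add_coe {ι κ : Type*} [Fintype ι] [Fintype κ] (P : Matrix ι κ ℝ) (k : κ → ℤ)
    (y : κ → AddCircle (1 : ℝ)) (x : ι → ℝ) :
    UnitAddTorus.mFourier k (fun j => y j + ((∑ i, P i j * x i : ℝ) : AddCircle (1 : ℝ))) =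
      UnitAddTorus.mFourier k y *
        ∏ i, Complex.exp (((2 * Real.pi * ∑ j, k j * P i j : ℝ) : ℂ) * Complex.I * x i) := by
  have hadd (j : κ) (u v : AddCircle (1 : ℝ)) :
      fourier (k j) (u + v) = fourier (k j) u * fourier (k j) v := by
    simp [fourier_apply, smul_add, AddCircle.toCircle_add]
  simp only [UnitAddTorus.mFourier, ContinuousMap.coe_mk, hadd, Finset.prod_mul_distrib]
  congr 1
  simp only [fourier_coe_apply, ← Complex.exp_sum]
  congr 1
  push_cast
  simp only [Finset.mul_sum, Finset.sum_mul, div_one]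
  rw [Finset.sum_comm]
  refine Finset.sum_congr rfl fun i _ => Finset.sum_congr rfl fun j _ => ?_
  ring

/-- **Kronecker–Weyl, ℝᵈ-action, Weyl-type equidistribution.**
If the columns `p₁, …, pₙ` of the `d × n` real matrix `P` are `ℚ`-linearly independent,
then for every continuous `F : 𝕋ⁿ → ℂ` and every `y ∈ 𝕋ⁿ`, the averages
`(2T)⁻ᵈ ∫_{[-T,T]^d} F(y + Pᵀ x mod ℤⁿ) dx` converge to `∫_{𝕋ⁿ} F dz` as `T → ∞`. -/
theorem weyl_equidistribution_Rd_action
    (d n : ℕ) (hd : 1 ≤ d) (hn : 1 ≤ n)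
    (P : Matrix (Fin d) (Fin n) ℝ)
    (hP : ∀ r : Fin n → ℚ, (∀ i : Fin d, ∑ j : Fin n, (r j : ℝ) * P i j = 0) → r = 0)
    (F : (Fin n → AddCircle (1 : ℝ)) → ℂ) (hF : Continuous F)
    (y : Fin n → AddCircle (1 : ℝ)) :
    Tendsto
      (fun T : ℝ => ((2 * T) ^ d)⁻¹ •
        ∫ x in Set.Icc (fun _ : Fin d => -T) (fun _ : Fin d => T),
          F (fun j : Fin n => y j + ((∑ i : Fin d, P i j * x i : ℝ) : AddCircle (1 : ℝ))))
      atTop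
      (nhds (∫ z, F z)) := by
  have hvol {T : ℝ} (hT : 0 < T) :
      volume.real (Set.Icc (fun _ : Fin d => -T) (fun _ : Fin d => T)) = (2 * T) ^ d := by
    rw [Measure.real, Real.volume_Icc_pi_toReal (fun _ => by linarith)]
    simp [two_mul]
  have hg : Continuous fun x : Fin d → ℝ =>
      (fun j : Fin n => y j + ((∑ i : Fin d, P i j * x i : ℝ) : AddCircle (1 : ℝ))) :=
    continuous_pi fun j => continuous_const.add
      ((AddCircle.continuous_mk' 1).comp (by fun_prop))
  refine (tendsto_setAverage_of_span_dense (μ := volume) (ν := volume)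
    (s := fun T : ℝ => Set.Icc (fun _ : Fin d => -T) (fun _ : Fin d => T))
    (fun T => isCompact_Icc.measure_ne_top) hg UnitAddTorus.span_mFourier_closure_eq_top
    ?_ ⟨F, hF⟩).congr' ?_
  · rintro _ ⟨k, rfl⟩
    set a : Fin d → ℝ := fun i => 2 * Real.pi * ∑ j, k j * P i j with ha
    have hlim : UnitAddTorus.mFourier k y * ∏ i, (if a i = 0 then (1 : ℂ) else 0) =
        ∫ z : Fin n → AddCircle (1 : ℝ), UnitAddTorus.mFourier k z := by
      rw [integral_mFourier]
      split_ifs with hk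
      · simp [ha, hk, UnitAddTorus.mFourier_zero]
      · have : ∃ i, a i ≠ 0 := by
          by_contra! h
          refine hk (funext fun j => ?_)
          have := congrFun (hP (fun j => (k j : ℚ)) fun i => by
            simpa [ha, Real.pi_ne_zero] using h i) j
          simpa using this
        obtain ⟨i, hi⟩ := this
        rw [Finset.prod_eq_zero (Finset.mem_univ i) (if_neg hi), mul_zero]
    rw [← hlim]
    refine ((tendsto_finsetProd Finset.univ fun i _ =>
      tendsto_average_exp_mul_I (a i)).const_mul (UnitAddTorus.mFourier k y)).congr' ?_
    filter_upwards [eventually_gt_atTop 0] with T hT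
    simp only [mFourier_add_coe]
    rw [setAverage_eq, hvol hT, integral_const_mul, ← Set.pi_univ_Icc, volume_pi,
      Measure.restrict_pi_pi, integral_fintype_prod_eq_prod
        (fun i (x : ℝ) => Complex.exp ((a i : ℂ) * Complex.I * x)), Finset.prod_mul_distrib,
      Complex.real_smul, Finset.prod_const, Finset.card_univ, Fintype.card_fin, inv_pow,
      Complex.ofReal_inv, Complex.ofReal_pow]
    exact mul_left_comm _ _ _
  · filter_upwards [eventually_gt_atTop 0] with T hT
    rw [setAverage_eq, hvol hT]
    rfl
end

section
/- Suppose the columns p₁,…,pₙ of P are ℚ-linearly independent. Let F : 𝕋ⁿ → ℂ be continuous and define f : ℝᵈ → ℂ by f(x) = F(Pᵀx mod ℤⁿ). Then sup_{x∈ℝᵈ} |f(x)| = sup_{y∈𝕋ⁿ} |F(y)|. -/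
open MeasureTheory

/-- A nontrivial character has vanishing integral against a translation-invariant measure. -/
theorem integral_eq_zero_of_map_add_eq_mul {G : Type*} [AddGroup G] [MeasurableSpace G]
    [MeasurableAdd G] (μ : Measure G) [μ.IsAddLeftInvariant] (χ : G → ℂ)
    (hχ : ∀ a b, χ (a + b) = χ a * χ b) {a : G} (ha : χ a ≠ 1) : ∫ x, χ x ∂μ = 0 := by
  have h := integral_add_left_eq_self (μ := μ) χ a
  simp only [hχ, integral_const_mul] at h
  by_contra h0
  exact ha (mul_right_cancel₀ h0 (h.trans (one_mul _).symm))

/-- Integration against a finite measure is continuous for the uniform norm. -/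
theorem ContinuousMap.continuous_integral {X : Type*} [TopologicalSpace X] [CompactSpace X]
    [MeasurableSpace X] [BorelSpace X] (μ : Measure X) [IsFiniteMeasure μ] :
    Continuous fun g : C(X, ℂ) => ∫ x, g x ∂μ := by
  have h := (MeasureTheory.continuous_integral (μ := μ) (G := ℂ)).comp
    (ContinuousMap.toLp (E := ℂ) 1 μ ℂ).continuous
  refine h.congr fun g => ?_
  exact (integral_congr_ae (ContinuousMap.coeFn_toLp μ g))

namespace UnitAddTorus

variable {ι : Type*} [Fintype ι]

theorem mFourier_apply_add (m : ι → ℤ) (x y : UnitAddTorus ι) :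
    mFourier m (x + y) = mFourier m x * mFourier m y := by
  simp [mFourier, Finset.prod_mul_distrib, fourier_apply, smul_add, AddCircle.toCircle_add]

/-- A subgroup of the torus on which no nontrivial character is trivial is dense. -/
theorem dense_of_mFourier_ne_one (S : AddSubgroup (UnitAddTorus ι))
    (hS : ∀ m : ι → ℤ, m ≠ 0 → ∃ s ∈ S, mFourier m s ≠ 1) :
    Dense (S : Set (UnitAddTorus ι)) := by
  set H := S.topologicalClosure
  have hHc : IsClosed (H : Set (UnitAddTorus ι)) := S.isClosed_topologicalClosure
  have : CompactSpace H := isCompact_iff_compactSpace.mp hHc.isCompact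
  let μ : Measure H := Measure.addHaar
  intro y
  change y ∈ H
  by_contra hy
  let r : C(H, UnitAddTorus ι) := ⟨fun h => h, by fun_prop⟩
  let t : C(H, UnitAddTorus ι) := ⟨fun h => h + y, by fun_prop⟩
  have hinv : ∀ g : C(UnitAddTorus ι, ℂ), ∫ h : H, g h ∂μ = ∫ h : H, g (h + y) ∂μ := by
    have hcl : IsClosed {g : C(UnitAddTorus ι, ℂ) | ∫ h : H, g h ∂μ = ∫ h : H, g (h + y) ∂μ} :=
      isClosed_eq
        ((ContinuousMap.continuous_integral μ).comp (ContinuousMap.continuous_precomp r))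
        ((ContinuousMap.continuous_integral μ).comp (ContinuousMap.continuous_precomp t))
    have hint : ∀ (g : C(UnitAddTorus ι, ℂ)) (s : C(H, UnitAddTorus ι)),
        Integrable (fun h => g (s h)) μ := fun g s =>
      (g.comp s).continuous.integrable_of_hasCompactSupport (HasCompactSupport.of_compactSpace _)
    intro g
    have hg : g ∈ (Submodule.span ℂ (Set.range (mFourier (d := ι)))).topologicalClosure := by
      rw [span_mFourier_closure_eq_top]; trivial
    refine closure_minimal (fun g hg => ?_) hcl hg
    induction hg using Submodule.span_induction with
    | mem g hg =>
      obtain ⟨m, rfl⟩ := hg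
      by_cases hm : m = 0
      · simp [hm, mFourier_zero]
      · obtain ⟨s, hs, hs1⟩ := hS m hm
        have h0 : ∫ h : H, mFourier m h ∂μ = 0 :=
          integral_eq_zero_of_map_add_eq_mul μ (fun h : H => mFourier m h)
            (fun a b => mFourier_apply_add m a b) (a := ⟨s, S.le_topologicalClosure hs⟩) hs1
        simp [mFourier_apply_add, integral_mul_const, h0]
    | zero => simp
    | add g₁ g₂ _ _ h₁ h₂ =>
      simp only [Set.mem_ofPred_eq, ContinuousMap.add_apply] at h₁ h₂ ⊢
      exact (integral_add (hint g₁ r) (hint g₂ r)).trans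
        ((congrArg₂ (· + ·) h₁ h₂).trans (integral_add (hint g₁ t) (hint g₂ t)).symm)
    | smul c g _ h₁ =>
      simp only [Set.mem_ofPred_eq, ContinuousMap.smul_apply] at h₁ ⊢
      rw [integral_smul, integral_smul, h₁]
  have hne : (H : Set (UnitAddTorus ι)).Nonempty := ⟨0, H.zero_mem⟩
  have hdist := hinv ⟨fun x => (Metric.infDist x (H : Set (UnitAddTorus ι)) : ℂ),
    Complex.continuous_ofReal.comp (Metric.continuous_infDist_pt _)⟩
  simp only [ContinuousMap.coe_mk, integral_complex_ofReal, Complex.ofReal_inj] at hdist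
  have hzero : ∀ h : H, Metric.infDist (h : UnitAddTorus ι) (H : Set (UnitAddTorus ι)) = 0 :=
    fun h => Metric.infDist_zero_of_mem h.2
  have hcont : Continuous fun h : H =>
      Metric.infDist ((h : UnitAddTorus ι) + y) (H : Set (UnitAddTorus ι)) :=
    (Metric.continuous_infDist_pt _).comp t.continuous
  have hpos : 0 < ∫ h : H, Metric.infDist ((h : UnitAddTorus ι) + y)
      (H : Set (UnitAddTorus ι)) ∂μ := by
    refine hcont.integral_pos_of_hasCompactSupport_nonneg_nonzero (x := 0)
      (HasCompactSupport.of_compactSpace _) (fun _ => Metric.infDist_nonneg) ?_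
    simpa using ((hHc.notMem_iff_infDist_pos hne).mp hy).ne'
  rw [← hdist] at hpos
  simp [hzero] at hpos

end UnitAddTorus

/-- If the columns `p₁, …, pₙ` of `P` are `ℚ`-linearly independent, and `f(x) = F(Pᵀx mod ℤⁿ)`
for a continuous `F : 𝕋ⁿ → ℂ`, then `sup_{x ∈ ℝᵈ} |f(x)| = sup_{y ∈ 𝕋ⁿ} |F(y)|`. -/
theorem sup_norm_quasiperiodic_eq_sup_norm_parent
    (d n : ℕ) (hd : 1 ≤ d) (hn : 1 ≤ n)
    (P : Matrix (Fin d) (Fin n) ℝ)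
    (hP : ∀ r : Fin n → ℚ, (∀ i : Fin d, ∑ j : Fin n, (r j : ℝ) * P i j = 0) → r = 0)
    (F : (Fin n → AddCircle (1 : ℝ)) → ℂ) (hF : Continuous F)
    (f : (Fin d → ℝ) → ℂ)
    (hf : ∀ x : Fin d → ℝ,
      f x = F (fun j : Fin n => ((∑ i : Fin d, P i j * x i : ℝ) : AddCircle (1 : ℝ)))) :
    (⨆ x : Fin d → ℝ, ‖f x‖) = ⨆ y : Fin n → AddCircle (1 : ℝ), ‖F y‖ := by
  let φ : (Fin d → ℝ) →+ UnitAddTorus (Fin n) :=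
    { toFun := fun x j => ((∑ i, P i j * x i : ℝ) : AddCircle (1 : ℝ))
      map_zero' := by ext j; simp
      map_add' := fun x y => by
        ext j
        simp [mul_add, Finset.sum_add_distrib] }
  have hφ : Dense (φ.range : Set (UnitAddTorus (Fin n))) := by
    refine UnitAddTorus.dense_of_mFourier_ne_one φ.range fun m hm => ?_
    obtain ⟨i, hi⟩ : ∃ i, ∑ j, (m j : ℝ) * P i j ≠ 0 := by
      by_contra! h
      refine hm (funext fun j => ?_)
      simpa using congrFun (hP (fun j => (m j : ℚ)) (by simpa using h)) j
    obtain ⟨c, hc⟩ : ∃ c, c = ∑ j, (m j : ℝ) * P i j := ⟨_, rfl⟩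
    rw [← hc] at hi
    refine ⟨_, ⟨Pi.single i (1 / (2 * c)), rfl⟩, ?_⟩
    have key : UnitAddTorus.mFourier m (φ (Pi.single i (1 / (2 * c)))) = -1 := by
      have h1 : ∀ j, φ (Pi.single i (1 / (2 * c))) j
          = ((P i j * (1 / (2 * c)) : ℝ) : AddCircle (1 : ℝ)) := fun j => by
        change ((∑ k, P k j * (Pi.single i (1 / (2 * c)) : Fin d → ℝ) k : ℝ) : AddCircle (1 : ℝ)) = _
        congr 1
        simp [Pi.single_apply]
      simp only [UnitAddTorus.mFourier, ContinuousMap.coe_mk, h1, fourier_coe_apply,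
        ← Complex.exp_sum]
      rw [← Complex.exp_pi_mul_I]
      congr 1
      have h2 : (c : ℂ) ≠ 0 := by exact_mod_cast hi
      have h3 : (c : ℂ) = ∑ j, (m j : ℂ) * P i j := by rw [hc]; push_cast; rfl
      calc _ = (Real.pi * Complex.I / c) * ∑ j, (m j : ℂ) * P i j := by
            rw [Finset.mul_sum]
            refine Finset.sum_congr rfl fun j _ => ?_
            push_cast
            field_simp
        _ = _ := by rw [← h3]; field_simp
    rw [key]
    norm_num
  have hbdd : BddAbove (Set.range fun y => ‖F y‖) := (isCompact_range hF.norm).bddAbove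
  simp only [hf]
  refine le_antisymm
    (ciSup_le fun x => le_ciSup hbdd (φ x)) (ciSup_le fun y => ?_)
  have hbdd' : BddAbove (Set.range fun x => ‖F (φ x)‖) :=
    hbdd.mono (Set.range_comp_subset_range φ fun y => ‖F y‖)
  refine hφ.induction (P := fun y => ‖F y‖ ≤ ⨆ x, ‖F (φ x)‖) ?_
    (isClosed_le hF.norm continuous_const) y
  rintro _ ⟨x, rfl⟩
  exact le_ciSup hbdd' x
end

section
/- Suppose the columns p₁,…,pₙ of P are ℚ-linearly independent. Let F : 𝕋ⁿ → ℂ be continuous and define f : ℝᵈ → ℂ by f(x) = F(Pᵀx mod ℤⁿ). Then for every k ∈ ℤⁿ, the Bohr–Fourier coefficient of f at the frequency Pk ∈ ℝᵈ exists and equals the Fourier coefficient of F at k: lim_{T→∞} (2T)^{-d} ∫_{[-T,T]^d} f(x) e^{-2πi (Pk)ᵀx} dx = F̂(k), where F̂(k) = ∫_{𝕋ⁿ} F(y) e^{-2πi kᵀy} dy. -/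
open MeasureTheory Filter Complex

/-- The value of a monomial on the torus at the class of a real vector. -/
lemma UnitAddTorus.mFourier_coe_apply {n : ℕ} (m : Fin n → ℤ) (y : Fin n → ℝ) :
    UnitAddTorus.mFourier m (fun j => ((y j : ℝ) : AddCircle (1 : ℝ))) =
      Complex.exp (2 * (Real.pi : ℂ) * Complex.I * ((∑ j, (m j : ℝ) * y j : ℝ) : ℂ)) := by
  simp only [UnitAddTorus.mFourier, ContinuousMap.coe_mk, fourier_coe_apply, ofReal_sum,
    Finset.mul_sum, Complex.exp_sum]
  refine Finset.prod_congr rfl fun j _ => ?_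
  congr 1
  push_cast
  ring

/-- The integral over a box of a product of functions of one variable each. -/
lemma integral_Icc_pi_prod_eq_prod {d : ℕ} (a b : Fin d → ℝ) (g : Fin d → ℝ → ℂ) :
    ∫ x in Set.Icc a b, ∏ i, g i (x i) = ∏ i, ∫ t in Set.Icc (a i) (b i), g i t := by
  rw [← Set.pi_univ_Icc, volume_pi, Measure.restrict_pi_pi]
  exact integral_fintype_prod_eq_prod g

/-- The means of a nontrivial character over symmetric intervals tend to zero. -/
lemma tendsto_mean_exp_mul_I (c : ℝ) :
    Tendsto (fun T : ℝ => (2 * T)⁻¹ • ∫ t in Set.Icc (-T) T,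
      Complex.exp (2 * (Real.pi : ℂ) * Complex.I * ((c * t : ℝ) : ℂ))) atTop
      (nhds (if c = 0 then 1 else 0)) := by
  split_ifs with hc
  · subst hc
    refine tendsto_const_nhds.congr' ?_
    filter_upwards [eventually_gt_atTop 0] with T hT
    have h2 : T + T = 2 * T := by ring
    have h4 : (T : ℂ) ≠ 0 := by exact_mod_cast hT.ne'
    simp [h2, Measure.real, ENNReal.toReal_ofReal hT.le]
    field_simp
  · set a : ℂ := 2 * (Real.pi : ℂ) * Complex.I * (c : ℂ) with ha
    have ha0 : a ≠ 0 := by simp [ha, hc, Real.pi_ne_zero]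
    have hlim : Tendsto (fun T : ℝ => (2 * T)⁻¹ * (2 / ‖a‖)) atTop (nhds 0) := by
      have := (tendsto_inv_atTop_zero.comp
        (tendsto_id.const_mul_atTop (zero_lt_two (α := ℝ)))).mul_const (2 / ‖a‖)
      simpa using this
    refine squeeze_zero_norm' ?_ hlim
    filter_upwards [eventually_gt_atTop 0] with T hT
    have hn : ∀ s : ℝ, ‖Complex.exp (a * s)‖ = 1 := fun s => by
      rw [Complex.norm_exp]
      simp [ha]
    rw [norm_smul, integral_Icc_eq_integral_Ioc,
      ← intervalIntegral.integral_of_le (by linarith : -T ≤ T)]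
    have he : ∀ t : ℝ, Complex.exp (2 * (Real.pi : ℂ) * Complex.I * ((c * t : ℝ) : ℂ)) =
        Complex.exp (a * t) := fun t => by rw [ha]; push_cast; ring_nf
    simp only [he]
    rw [integral_exp_mul_complex ha0, norm_div, Real.norm_of_nonneg (by positivity)]
    gcongr
    refine (norm_sub_le _ _).trans ?_
    rw [hn, hn]
    norm_num

/-- The integral over a period of a character with integral frequency. -/
lemma integral_exp_two_pi_I_int (m : ℤ) :
    ∫ t in Set.Icc (0 : ℝ) 1,
      Complex.exp (2 * (Real.pi : ℂ) * Complex.I * (((m : ℝ) * t : ℝ) : ℂ)) =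
      if m = 0 then 1 else 0 := by
  split_ifs with hm
  · simp [hm]
  · have ha0 : 2 * (Real.pi : ℂ) * Complex.I * (m : ℂ) ≠ 0 := by simp [hm, Real.pi_ne_zero]
    rw [integral_Icc_eq_integral_Ioc, ← intervalIntegral.integral_of_le zero_le_one]
    have he : ∀ t : ℝ, Complex.exp (2 * (Real.pi : ℂ) * Complex.I * (((m : ℝ) * t : ℝ) : ℂ)) =
        Complex.exp (2 * (Real.pi : ℂ) * Complex.I * (m : ℂ) * t) := fun t => by
      push_cast; ring_nf
    simp only [he]
    rw [integral_exp_mul_complex ha0]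
    have : Complex.exp (2 * (Real.pi : ℂ) * Complex.I * (m : ℂ)) = 1 :=
      Complex.exp_eq_one_iff.2 ⟨m, by ring⟩
    simp [this]

/-- A character of `ℝᵈ` is a product of characters of `ℝ`. -/
lemma exp_two_pi_I_sum {d : ℕ} (c x : Fin d → ℝ) :
    Complex.exp (2 * (Real.pi : ℂ) * Complex.I * ((∑ i, c i * x i : ℝ) : ℂ)) =
      ∏ i, Complex.exp (2 * (Real.pi : ℂ) * Complex.I * ((c i * x i : ℝ) : ℂ)) := by
  rw [← Complex.exp_sum, ofReal_sum, Finset.mul_sum]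

/-- The means of a character of `ℝᵈ` over growing cubes. -/
lemma tendsto_mean_exp_pi {d : ℕ} (c : Fin d → ℝ) :
    Tendsto (fun T : ℝ => ((2 * T) ^ d)⁻¹ •
      ∫ x in Set.Icc (fun _ : Fin d => -T) (fun _ : Fin d => T),
        Complex.exp (2 * (Real.pi : ℂ) * Complex.I * ((∑ i, c i * x i : ℝ) : ℂ))) atTop
      (nhds (if c = 0 then 1 else 0)) := by
  have h := tendsto_finsetProd Finset.univ fun i _ => tendsto_mean_exp_mul_I (c i)
  rw [Fintype.prod_ite_zero] at h
  simp only [Finset.prod_const_one] at h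
  simp only [funext_iff, Pi.zero_apply]
  refine h.congr fun T => ?_
  simp only [exp_two_pi_I_sum]
  rw [integral_Icc_pi_prod_eq_prod (fun _ : Fin d => -T) (fun _ => T)
    (fun i t => Complex.exp (2 * (Real.pi : ℂ) * Complex.I * ((c i * t : ℝ) : ℂ)))]
  simp [real_smul, Finset.prod_mul_distrib, mul_pow, mul_comm]

/-- The integral of a monomial over the unit cube. -/
lemma integral_exp_pi_int {n : ℕ} (m : Fin n → ℤ) :
    ∫ y in Set.Icc (0 : Fin n → ℝ) 1,
      Complex.exp (2 * (Real.pi : ℂ) * Complex.I * ((∑ j, (m j : ℝ) * y j : ℝ) : ℂ)) =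
      if m = 0 then 1 else 0 := by
  simp only [exp_two_pi_I_sum fun j => (m j : ℝ)]
  rw [integral_Icc_pi_prod_eq_prod 0 1
    (fun j t => Complex.exp (2 * (Real.pi : ℂ) * Complex.I * (((m j : ℝ) * t : ℝ) : ℂ)))]
  simp only [Pi.zero_apply, Pi.one_apply, integral_exp_two_pi_I_int]
  rw [Fintype.prod_ite_zero]
  simp [funext_iff]

/-- Integrals over a box differ by at most its volume times a uniform bound on the difference of
the integrands. -/
lemma norm_setIntegral_Icc_sub_le {d : ℕ} {a b : Fin d → ℝ} {u v : (Fin d → ℝ) → ℂ}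
    (hu : Continuous u) (hv : Continuous v) {C : ℝ} (h : ∀ x, ‖u x - v x‖ ≤ C) :
    ‖(∫ x in Set.Icc a b, u x) - ∫ x in Set.Icc a b, v x‖ ≤
      C * volume.real (Set.Icc a b) := by
  rw [← integral_sub (hu.integrableOn_Icc) (hv.integrableOn_Icc)]
  exact norm_setIntegral_le_of_norm_le_const isCompact_Icc.measure_lt_top fun x _ => h x

/-- Equidistribution of a linear flow with rationally independent frequencies. -/
lemma tendsto_mean_linear_flow {d n : ℕ} (P : Matrix (Fin d) (Fin n) ℝ)
    (hP : ∀ r : Fin n → ℚ, (∀ i : Fin d, ∑ j : Fin n, (r j : ℝ) * P i j = 0) → r = 0)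
    (G : C(UnitAddTorus (Fin n), ℂ)) :
    Tendsto (fun T : ℝ => ((2 * T) ^ d)⁻¹ •
      ∫ x in Set.Icc (fun _ : Fin d => -T) (fun _ : Fin d => T),
        G (fun j : Fin n => ((∑ i : Fin d, P i j * x i : ℝ) : AddCircle (1 : ℝ)))) atTop
      (nhds (∫ y in Set.Icc (0 : Fin n → ℝ) 1,
        G (fun j : Fin n => ((y j : ℝ) : AddCircle (1 : ℝ))))) := by
  have hcoe : Continuous fun t : ℝ => (t : AddCircle (1 : ℝ)) := AddCircle.continuous_mk' 1
  have hflow : ∀ g : C(UnitAddTorus (Fin n), ℂ), Continuous fun x : Fin d → ℝ =>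
      g (fun j : Fin n => ((∑ i : Fin d, P i j * x i : ℝ) : AddCircle (1 : ℝ))) := fun g =>
    g.continuous.comp (continuous_pi fun j => hcoe.comp (by fun_prop))
  have hproj : ∀ g : C(UnitAddTorus (Fin n), ℂ), Continuous fun y : Fin n → ℝ =>
      g (fun j : Fin n => ((y j : ℝ) : AddCircle (1 : ℝ))) := fun g =>
    g.continuous.comp (continuous_pi fun j => hcoe.comp (by fun_prop))
  have hspan : ∀ g ∈ Submodule.span ℂ (Set.range (UnitAddTorus.mFourier (d := Fin n))),
      Tendsto (fun T : ℝ => ((2 * T) ^ d)⁻¹ •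
        ∫ x in Set.Icc (fun _ : Fin d => -T) (fun _ : Fin d => T),
          g (fun j : Fin n => ((∑ i : Fin d, P i j * x i : ℝ) : AddCircle (1 : ℝ)))) atTop
        (nhds (∫ y in Set.Icc (0 : Fin n → ℝ) 1,
          g (fun j : Fin n => ((y j : ℝ) : AddCircle (1 : ℝ))))) := by
    intro g hg
    induction hg using Submodule.span_induction with
    | mem g hg =>
      obtain ⟨m, rfl⟩ := hg
      simp only [UnitAddTorus.mFourier_coe_apply]
      rw [integral_exp_pi_int]
      have hsum : ∀ x : Fin d → ℝ, ∑ j, (m j : ℝ) * ∑ i, P i j * x i =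
          ∑ i, (∑ j, (m j : ℝ) * P i j) * x i := fun x => by
        simp only [Finset.mul_sum, Finset.sum_mul]
        rw [Finset.sum_comm]
        simp only [mul_assoc]
      simp only [hsum]
      have hiff : (fun i => ∑ j, (m j : ℝ) * P i j) = 0 ↔ m = 0 := by
        refine ⟨fun h => ?_, fun h => by subst h; ext i; simp⟩
        have h0 := hP (fun j => (m j : ℚ)) fun i => by simpa using congrFun h i
        ext j
        simpa using congrFun h0 j
      simpa only [hiff] using tendsto_mean_exp_pi fun i => ∑ j, (m j : ℝ) * P i j
    | zero => simp
    | add g g' _ _ h h' =>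
      simp only [ContinuousMap.add_apply]
      rw [integral_add (hproj g).integrableOn_Icc (hproj g').integrableOn_Icc]
      refine (h.add h').congr fun T => ?_
      rw [integral_add (hflow g).integrableOn_Icc (hflow g').integrableOn_Icc, smul_add]
    | smul z g _ h =>
      simp only [ContinuousMap.smul_apply, integral_smul]
      refine (h.const_smul z).congr fun T => ?_
      rw [smul_comm]
  rw [Metric.tendsto_atTop']
  intro ε hε
  have hG : G ∈ closure
      (Submodule.span ℂ (Set.range (UnitAddTorus.mFourier (d := Fin n))) : Set _) := by
    rw [← Submodule.topologicalClosure_coe, UnitAddTorus.span_mFourier_closure_eq_top]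
    trivial
  obtain ⟨g, hg, hgG⟩ := Metric.mem_closure_iff.1 hG (ε / 3) (by positivity)
  obtain ⟨N, hN⟩ := (Metric.tendsto_atTop'.1 (hspan g hg)) (ε / 3) (by positivity)
  refine ⟨max N 0, fun T hT => ?_⟩
  have hT0 : 0 < T := (le_max_right _ _).trans_lt hT
  have hclose : ∀ z, ‖G z - g z‖ ≤ dist G g := fun z => by
    rw [← dist_eq_norm]
    exact ContinuousMap.dist_apply_le_dist z
  have h1 := norm_setIntegral_Icc_sub_le (a := fun _ : Fin d => -T) (b := fun _ => T)
    (hflow G) (hflow g) (fun x => hclose _)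
  have h2 := norm_setIntegral_Icc_sub_le (a := (0 : Fin n → ℝ)) (b := 1)
    (hproj G) (hproj g) (fun x => hclose _)
  have hv1 : volume.real (Set.Icc (fun _ : Fin d => -T) (fun _ => T)) = (2 * T) ^ d := by
    rw [Measure.real, Real.volume_Icc_pi_toReal (fun _ => by linarith)]
    simp [two_mul]
  have hv2 : volume.real (Set.Icc (0 : Fin n → ℝ) 1) = 1 := by
    rw [Measure.real, Real.volume_Icc_pi_toReal zero_le_one]
    simp
  rw [hv1] at h1
  rw [hv2, mul_one, ← dist_eq_norm] at h2
  have hpos : 0 < (2 * T) ^ d := by positivity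
  have h1' := mul_le_mul_of_nonneg_left h1 (inv_nonneg.2 hpos.le)
  rw [mul_comm (dist G g), inv_mul_cancel_left₀ hpos.ne',
    ← Real.norm_of_nonneg (inv_nonneg.2 hpos.le), ← norm_smul, smul_sub, ← dist_eq_norm] at h1'
  have h3 := hN T ((le_max_left _ _).trans_lt hT)
  rw [dist_comm] at h2
  exact (dist_triangle4 _ _ _ _).trans_lt
    ((add_lt_add_of_lt_of_le (add_lt_add_of_le_of_lt h1' h3) h2).trans (by linarith))

/-- If the columns `p₁, …, pₙ` of `P` are `ℚ`-linearly independent, `F : 𝕋ⁿ → ℂ` is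
continuous, and `f(x) = F(Pᵀx mod ℤⁿ)`, then for every `k ∈ ℤⁿ` the Bohr–Fourier
coefficient of `f` at the frequency `Pk ∈ ℝᵈ` exists and equals the Fourier
coefficient `F̂(k) = ∫_{𝕋ⁿ} F(y) e^{-2πi kᵀy} dy` of `F` (the latter written as an
integral over the fundamental domain `[0,1]ⁿ`). -/
theorem bohr_fourier_coeff_eq_fourier_coeff_parent
    (d n : ℕ) (hd : 1 ≤ d) (hn : 1 ≤ n)
    (P : Matrix (Fin d) (Fin n) ℝ)
    (hP : ∀ r : Fin n → ℚ, (∀ i : Fin d, ∑ j : Fin n, (r j : ℝ) * P i j = 0) → r = 0)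
    (F : (Fin n → AddCircle (1 : ℝ)) → ℂ) (hF : Continuous F)
    (f : (Fin d → ℝ) → ℂ)
    (hf : ∀ x : Fin d → ℝ,
      f x = F (fun j : Fin n => ((∑ i : Fin d, P i j * x i : ℝ) : AddCircle (1 : ℝ))))
    (k : Fin n → ℤ) :
    Tendsto
      (fun T : ℝ => ((2 * T) ^ d)⁻¹ •
        ∫ x in Set.Icc (fun _ : Fin d => -T) (fun _ : Fin d => T),
          f x * Complex.exp (-2 * (Real.pi : ℂ) * Complex.I *
            ((∑ i : Fin d, (∑ j : Fin n, P i j * (k j : ℝ)) * x i : ℝ) : ℂ)))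
      atTop
      (nhds (∫ y in Set.Icc (0 : Fin n → ℝ) 1,
        F (fun j : Fin n => ((y j : ℝ) : AddCircle (1 : ℝ))) *
          Complex.exp (-2 * (Real.pi : ℂ) * Complex.I *
            ((∑ j : Fin n, (k j : ℝ) * y j : ℝ) : ℂ)))) := by

  have hG : Continuous fun z => F z * UnitAddTorus.mFourier (-k) z :=
    hF.mul (UnitAddTorus.mFourier (-k)).continuous
  have h := tendsto_mean_linear_flow P hP ⟨_, hG⟩
  simp only [ContinuousMap.coe_mk, UnitAddTorus.mFourier_coe_apply] at h
  have hneg : ∀ y : Fin n → ℝ,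
      Complex.exp (2 * (Real.pi : ℂ) * Complex.I *
        ((∑ j, (((-k) j : ℤ) : ℝ) * y j : ℝ) : ℂ)) =
      Complex.exp (-2 * (Real.pi : ℂ) * Complex.I * ((∑ j, (k j : ℝ) * y j : ℝ) : ℂ)) := by
    intro y
    simp [Finset.sum_neg_distrib]
  have hsum : ∀ x : Fin d → ℝ, ∑ i, (∑ j, P i j * (k j : ℝ)) * x i =
      ∑ j, (k j : ℝ) * ∑ i, P i j * x i := fun x => by
    simp only [Finset.mul_sum, Finset.sum_mul]
    rw [Finset.sum_comm]
    exact Finset.sum_congr rfl fun j _ => Finset.sum_congr rfl fun i _ => by ring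
  simp only [hneg] at h
  simpa only [hf, hsum] using h
end

section
/- Suppose the columns p₁,…,pₙ of P are ℚ-linearly independent. Let F : 𝕋ⁿ → ℂ be continuous and define f : ℝᵈ → ℂ by f(x) = F(Pᵀx mod ℤⁿ). Then for every λ ∈ ℝᵈ that is not of the form λ = Pk for some k ∈ ℤⁿ, the Bohr–Fourier coefficient of f at λ exists and vanishes: lim_{T→∞} (2T)^{-d} ∫_{[-T,T]^d} f(x) e^{-2πi λᵀx} dx = 0. Consequently the Bohr spectrum of f equals P(Σ_F), where Σ_F is the set of k ∈ ℤⁿ with F̂(k) ≠ 0. -/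
open MeasureTheory Filter Complex

/-- On a cube, the integral of a character of `ℝ^ι` factors into one-dimensional integrals. -/
lemma setIntegral_cube_exp {ι : Type*} [Fintype ι] {a b : ℝ} (hab : a ≤ b) (μ : ι → ℝ) :
    ∫ x in Set.Icc (fun _ : ι => a) (fun _ : ι => b),
      exp (2 * (Real.pi : ℂ) * I * ((∑ i, μ i * x i : ℝ) : ℂ)) =
    ∏ i, ∫ t in a..b, exp (2 * (Real.pi : ℂ) * I * μ i * t) := by
  rw [← Set.pi_univ_Icc, volume_pi, Measure.restrict_pi_pi]
  simp_rw [intervalIntegral.integral_of_le hab, ← integral_Icc_eq_integral_Ioc]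
  rw [← integral_fintype_prod_eq_prod]
  refine integral_congr_ae (Eventually.of_forall fun x => ?_)
  simp only [← exp_sum]
  push_cast
  rw [Finset.mul_sum]
  exact congrArg exp (Finset.sum_congr rfl fun i _ => by ring)

lemma setIntegral_unitCube_exp {ι : Type*} [Fintype ι] [DecidableEq ι] (k : ι → ℤ) :
    ∫ x in Set.Icc (0 : ι → ℝ) 1,
      exp (2 * (Real.pi : ℂ) * I * ((∑ i, (k i : ℝ) * x i : ℝ) : ℂ)) =
    if k = 0 then 1 else 0 := by
  refine (setIntegral_cube_exp zero_le_one fun i => (k i : ℝ)).trans ?_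
  split_ifs with hk
  · simp [hk]
  · obtain ⟨i, hi⟩ := Function.ne_iff.mp hk
    refine Finset.prod_eq_zero (Finset.mem_univ i) ?_
    have hi' : (k i : ℂ) ≠ 0 := by exact_mod_cast hi
    have hc : 2 * (Real.pi : ℂ) * I * ((k i : ℝ) : ℂ) ≠ 0 := by
      push_cast
      exact mul_ne_zero two_pi_I_ne_zero hi'
    rw [integral_exp_mul_complex hc]
    have h1 : exp (2 * (Real.pi : ℂ) * I * ((k i : ℝ) : ℂ) * ((1 : ℝ) : ℂ)) = 1 := by
      rw [exp_eq_one_iff]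
      exact ⟨k i, by push_cast; ring⟩
    rw [h1]
    simp

lemma tendsto_average_exp (μ : ℝ) :
    Tendsto (fun T : ℝ => ((2 * T)⁻¹ : ℂ) *
      ∫ t in (-T)..T, exp (2 * (Real.pi : ℂ) * I * μ * t)) atTop
      (nhds (if μ = 0 then 1 else 0)) := by
  split_ifs with hμ
  · refine tendsto_const_nhds.congr' ?_
    filter_upwards [eventually_gt_atTop 0] with T hT
    have : (T : ℂ) ≠ 0 := by exact_mod_cast hT.ne'
    simp [hμ]
    field_simp
    ring
  · have hc : 2 * (Real.pi : ℂ) * I * μ ≠ 0 :=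
      mul_ne_zero two_pi_I_ne_zero (by exact_mod_cast hμ)
    have hexp (s : ℝ) : ‖exp (2 * (Real.pi : ℂ) * I * μ * s)‖ = 1 := by
      have : 2 * (Real.pi : ℂ) * I * μ * s = ((2 * Real.pi * μ * s : ℝ) : ℂ) * I := by
        push_cast; ring
      rw [this, norm_exp_ofReal_mul_I]
    have h0 : Tendsto (fun T : ℝ => (2 * T)⁻¹ * (2 / ‖2 * (Real.pi : ℂ) * I * μ‖)) atTop
        (nhds 0) := by
      simpa using ((tendsto_id.const_mul_atTop (zero_lt_two' ℝ)).inv_tendsto_atTop).mul_const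
        (2 / ‖2 * (Real.pi : ℂ) * I * μ‖)
    refine squeeze_zero_norm' ?_ h0
    filter_upwards [eventually_gt_atTop 0] with T hT
    rw [integral_exp_mul_complex hc, norm_mul, norm_div]
    have hn : ‖((2 * T)⁻¹ : ℂ)‖ = (2 * T)⁻¹ := by
      rw [norm_inv, norm_mul]
      simp [abs_of_pos hT]
    rw [hn]
    gcongr
    refine (norm_sub_le _ _).trans ?_
    rw [hexp, hexp]
    norm_num

lemma tendsto_cube_average_exp {ι : Type*} [Fintype ι] [DecidableEq ι] (μ : ι → ℝ) :
    Tendsto (fun T : ℝ => (((2 * T) ^ Fintype.card ι)⁻¹ : ℂ) *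
      ∫ x in Set.Icc (fun _ : ι => -T) (fun _ : ι => T),
        exp (2 * (Real.pi : ℂ) * I * ((∑ i, μ i * x i : ℝ) : ℂ))) atTop
      (nhds (if μ = 0 then 1 else 0)) := by
  have hlim : (if μ = 0 then (1 : ℂ) else 0) = ∏ i, if μ i = 0 then (1 : ℂ) else 0 := by
    rw [Finset.prod_ite_zero]
    simp [funext_iff]
  rw [hlim]
  refine (tendsto_finsetProd _ fun i _ => tendsto_average_exp (μ i)).congr' ?_
  filter_upwards [eventually_ge_atTop 0] with T hT
  rw [setIntegral_cube_exp (by linarith), Finset.prod_mul_distrib, Finset.prod_const, Finset.card_univ,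
    inv_pow]

/-- Convergence of uniformly bounded linear functionals can be tested on a set with dense span. -/
lemma tendsto_of_span_dense {E α : Type*} [NormedAddCommGroup E] [NormedSpace ℂ E]
    {l : Filter α} {A : α → E →ₗ[ℂ] ℂ} {L : E →ₗ[ℂ] ℂ} {s : Set E}
    (hs : (Submodule.span ℂ s).topologicalClosure = ⊤)
    (hA : ∀ᶠ t in l, ∀ x, ‖A t x‖ ≤ ‖x‖) (hL : ∀ x, ‖L x‖ ≤ ‖x‖)
    (h : ∀ x ∈ s, Tendsto (fun t => A t x) l (nhds (L x))) (x : E) :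
    Tendsto (fun t => A t x) l (nhds (L x)) := by
  have hspan : ∀ y ∈ Submodule.span ℂ s, Tendsto (fun t => A t y) l (nhds (L y)) := by
    intro y hy
    induction hy using Submodule.span_induction with
    | mem y hy => exact h y hy
    | zero => simpa using tendsto_const_nhds
    | add y z _ _ hy hz => simpa using hy.add hz
    | smul c y _ hy => simpa using hy.const_mul c
  have hx : x ∈ closure (Submodule.span ℂ s : Set E) := by
    rw [← Submodule.topologicalClosure_coe, hs]
    trivial
  rw [Metric.tendsto_nhds]
  intro ε hε
  obtain ⟨y, hy, hxy⟩ := Metric.mem_closure_iff.mp hx (ε / 3) (by positivity)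
  rw [dist_eq_norm] at hxy
  filter_upwards [hA, Metric.tendsto_nhds.mp (hspan y hy) (ε / 3) (by positivity)] with t ht hty
  rw [dist_eq_norm] at hty ⊢
  have h1 := ht (x - y)
  have h2 := hL (x - y)
  rw [map_sub] at h1 h2
  calc ‖A t x - L x‖ = ‖(A t x - A t y) + (A t y - L y) - (L x - L y)‖ := by congr 1; ring
    _ ≤ ‖A t x - A t y‖ + ‖A t y - L y‖ + ‖L x - L y‖ :=
      (norm_sub_le _ _).trans (by gcongr; exact norm_add_le _ _)
    _ < ε := by linarith

lemma norm_exp_neg_two_pi_I_mul (s : ℝ) : ‖exp (-2 * (Real.pi : ℂ) * I * (s : ℂ))‖ = 1 := by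
  have : -2 * (Real.pi : ℂ) * I * (s : ℂ) = ((-2 * Real.pi * s : ℝ) : ℂ) * I := by
    push_cast; ring
  rw [this, norm_exp_ofReal_mul_I]

/-- The functional `G ↦ c ∫ₛ G(Φ(x)) e^{-2πi νᵀx} dx` on continuous functions, for `s` compact and
`Φ` continuous. -/
noncomputable def twistedIntegral {ι X : Type*} [Fintype ι] [TopologicalSpace X]
    {s : Set (ι → ℝ)} (hs : IsCompact s) {Φ : (ι → ℝ) → X} (hΦ : Continuous Φ)
    (ν : ι → ℝ) (c : ℂ) : C(X, ℂ) →ₗ[ℂ] ℂ where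
  toFun G := c * ∫ x in s, G (Φ x) * exp (-2 * (Real.pi : ℂ) * I * ((∑ i, ν i * x i : ℝ) : ℂ))
  map_add' G H := by
    have hint (K : C(X, ℂ)) : IntegrableOn (fun x => K (Φ x) *
        exp (-2 * (Real.pi : ℂ) * I * ((∑ i, ν i * x i : ℝ) : ℂ))) s := by
      refine ContinuousOn.integrableOn_compact hs (Continuous.continuousOn ?_)
      have := K.continuous.comp hΦ
      fun_prop
    rw [← mul_add, ← integral_add (hint G) (hint H)]
    simp [add_mul]
  map_smul' a G := by
    simp only [ContinuousMap.smul_apply, smul_eq_mul, RingHom.id_apply, mul_assoc a]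
    rw [integral_const_mul]
    ring

lemma norm_twistedIntegral_le {ι X : Type*} [Fintype ι] [TopologicalSpace X] [CompactSpace X]
    {s : Set (ι → ℝ)} (hs : IsCompact s) {Φ : (ι → ℝ) → X} (hΦ : Continuous Φ)
    (ν : ι → ℝ) {c : ℂ} (hc : ‖c‖ * volume.real s ≤ 1) (G : C(X, ℂ)) :
    ‖twistedIntegral hs hΦ ν c G‖ ≤ ‖G‖ := by
  have h := norm_setIntegral_le_of_norm_le_const (μ := volume) (C := ‖G‖) hs.measure_lt_top
    (f := fun x => G (Φ x) * exp (-2 * (Real.pi : ℂ) * I * ((∑ i, ν i * x i : ℝ) : ℂ)))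
    (fun x _ => by
      rw [norm_mul, norm_exp_neg_two_pi_I_mul, mul_one]
      exact G.norm_coe_le_norm _)
  calc ‖twistedIntegral hs hΦ ν c G‖ ≤ ‖c‖ * (‖G‖ * volume.real s) := by
        simp only [twistedIntegral, LinearMap.coe_mk, AddHom.coe_mk, norm_mul]
        gcongr
    _ = ‖c‖ * volume.real s * ‖G‖ := by ring
    _ ≤ ‖G‖ := mul_le_of_le_one_left (norm_nonneg _) hc

lemma mFourier_coe {ι : Type*} [Fintype ι] (k : ι → ℤ) (y : ι → ℝ) :
    UnitAddTorus.mFourier k (fun j => (y j : AddCircle (1 : ℝ))) =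
      exp (2 * (Real.pi : ℂ) * I * ((∑ j, (k j : ℝ) * y j : ℝ) : ℂ)) := by
  simp only [UnitAddTorus.mFourier, ContinuousMap.coe_mk, fourier_coe_apply, ← exp_sum]
  push_cast
  rw [Finset.mul_sum]
  exact congrArg exp (Finset.sum_congr rfl fun i _ => by ring)

lemma continuous_torus_proj {d n : Type*} [Fintype d] (P : Matrix d n ℝ) :
    Continuous fun (x : d → ℝ) (j : n) => ((∑ i, P i j * x i : ℝ) : AddCircle (1 : ℝ)) :=
  continuous_pi fun j => (AddCircle.continuous_mk' 1).comp (by fun_prop)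

lemma continuous_torus_mk {n : Type*} :
    Continuous fun (y : n → ℝ) (j : n) => (y j : AddCircle (1 : ℝ)) :=
  continuous_pi fun j => (AddCircle.continuous_mk' 1).comp (continuous_apply j)

/-- The mean value functional `G ↦ (2T)^{-d} ∫_{[-T,T]^d} G(Pᵀx) e^{-2πi νᵀx} dx`. -/
noncomputable def bohrAverage {d n : ℕ} (P : Matrix (Fin d) (Fin n) ℝ) (ν : Fin d → ℝ) (T : ℝ) :
    C(UnitAddTorus (Fin n), ℂ) →ₗ[ℂ] ℂ :=
  twistedIntegral (isCompact_Icc (a := fun _ : Fin d => -T) (b := fun _ => T))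
    (continuous_torus_proj P) ν ((2 * T) ^ d)⁻¹

/-- The Fourier coefficient functional, written as an integral over the unit cube. -/
noncomputable def cubeCoeff {n : ℕ} (k : Fin n → ℤ) : C(UnitAddTorus (Fin n), ℂ) →ₗ[ℂ] ℂ :=
  twistedIntegral (isCompact_Icc (a := (0 : Fin n → ℝ)) (b := 1)) continuous_torus_mk
    (fun j => (k j : ℝ)) 1

lemma norm_cubeCoeff_le {n : ℕ} (k : Fin n → ℤ) (G : C(UnitAddTorus (Fin n), ℂ)) :
    ‖cubeCoeff k G‖ ≤ ‖G‖ := by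
  refine norm_twistedIntegral_le _ _ _ ?_ G
  rw [Measure.real, Real.volume_Icc_pi_toReal zero_le_one]
  simp

lemma norm_bohrAverage_le {d n : ℕ} (P : Matrix (Fin d) (Fin n) ℝ) (ν : Fin d → ℝ) {T : ℝ}
    (hT : 0 < T) (G : C(UnitAddTorus (Fin n), ℂ)) : ‖bohrAverage P ν T G‖ ≤ ‖G‖ := by
  refine norm_twistedIntegral_le _ _ _ ?_ G
  rw [Measure.real, Real.volume_Icc_pi_toReal (fun _ => by simp; linarith)]
  have h2 : T - -T = 2 * T := by ring
  simp only [h2, Finset.prod_const, Finset.card_univ, Fintype.card_fin, norm_inv, norm_pow,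
    norm_mul, norm_real, Real.norm_of_nonneg hT.le]
  rw [Complex.norm_ofNat, inv_mul_cancel₀ (by positivity)]

lemma cubeCoeff_mFourier {n : ℕ} (k m : Fin n → ℤ) :
    cubeCoeff k (UnitAddTorus.mFourier m) = if m = k then 1 else 0 := by
  have h := setIntegral_unitCube_exp (m - k)
  simp only [sub_eq_zero] at h
  rw [← h]
  simp only [cubeCoeff, twistedIntegral, LinearMap.coe_mk, AddHom.coe_mk, one_mul, mFourier_coe,
    ← exp_add]
  refine integral_congr_ae (Eventually.of_forall fun y => congrArg exp ?_)
  simp only [Pi.sub_apply, Int.cast_sub, sub_mul, Finset.sum_sub_distrib]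
  push_cast
  ring

lemma tendsto_bohrAverage_mFourier {d n : ℕ} (P : Matrix (Fin d) (Fin n) ℝ) (ν : Fin d → ℝ)
    (m : Fin n → ℤ) :
    Tendsto (fun T => bohrAverage P ν T (UnitAddTorus.mFourier m)) atTop
      (nhds (if (fun i => ∑ j, P i j * (m j : ℝ)) = ν then 1 else 0)) := by
  have h := tendsto_cube_average_exp ((fun i => ∑ j, P i j * (m j : ℝ)) - ν)
  simp only [sub_eq_zero, Fintype.card_fin] at h
  refine h.congr fun T => ?_
  simp only [bohrAverage, twistedIntegral, LinearMap.coe_mk, AddHom.coe_mk, mFourier_coe,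
    ← exp_add]
  congr 1
  refine integral_congr_ae (Eventually.of_forall fun x => congrArg exp ?_)
  have hswap : ∑ i, (∑ j, P i j * (m j : ℝ)) * x i = ∑ j, (m j : ℝ) * ∑ i, P i j * x i := by
    simp only [Finset.sum_mul, Finset.mul_sum]
    rw [Finset.sum_comm]
    exact Finset.sum_congr rfl fun _ _ => Finset.sum_congr rfl fun _ _ => by ring
  simp only [Pi.sub_apply, sub_mul, Finset.sum_sub_distrib]
  rw [hswap]
  push_cast
  ring

lemma tendsto_bohrAverage_zero {d n : ℕ} (P : Matrix (Fin d) (Fin n) ℝ) (ν : Fin d → ℝ)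
    (hν : ∀ k : Fin n → ℤ, ν ≠ fun i => ∑ j, P i j * (k j : ℝ))
    (G : C(UnitAddTorus (Fin n), ℂ)) :
    Tendsto (fun T => bohrAverage P ν T G) atTop (nhds 0) := by
  refine tendsto_of_span_dense (L := 0) UnitAddTorus.span_mFourier_closure_eq_top
    ((eventually_gt_atTop 0).mono fun T hT => norm_bohrAverage_le P ν hT) (by simp) ?_ G
  rintro _ ⟨m, rfl⟩
  simpa [(hν m).symm] using tendsto_bohrAverage_mFourier P ν m

lemma tendsto_bohrAverage_cubeCoeff {d n : ℕ} (P : Matrix (Fin d) (Fin n) ℝ)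
    (hP : ∀ r : Fin n → ℚ, (∀ i : Fin d, ∑ j : Fin n, (r j : ℝ) * P i j = 0) → r = 0)
    (k : Fin n → ℤ) (G : C(UnitAddTorus (Fin n), ℂ)) :
    Tendsto (fun T => bohrAverage P (fun i => ∑ j, P i j * (k j : ℝ)) T G) atTop
      (nhds (cubeCoeff k G)) := by
  refine tendsto_of_span_dense UnitAddTorus.span_mFourier_closure_eq_top
    ((eventually_gt_atTop 0).mono fun T hT => norm_bohrAverage_le P _ hT)
    (norm_cubeCoeff_le k) ?_ G
  rintro _ ⟨m, rfl⟩
  have hinj : (fun i => ∑ j, P i j * (m j : ℝ)) = (fun i => ∑ j, P i j * (k j : ℝ)) ↔ m = k := by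
    refine ⟨fun h => ?_, fun h => by rw [h]⟩
    have hr := hP (fun j => ((m j - k j : ℤ) : ℚ)) fun i => by
      have hi : ∑ j, P i j * (m j : ℝ) = ∑ j, P i j * (k j : ℝ) := congrFun h i
      rw [← sub_eq_zero, ← Finset.sum_sub_distrib] at hi
      rw [← hi]
      exact Finset.sum_congr rfl fun j _ => by push_cast; ring
    funext j
    have hj := congrFun hr j
    simp only [Pi.zero_apply, Int.cast_eq_zero] at hj
    omega
  have h := tendsto_bohrAverage_mFourier P (fun i => ∑ j, P i j * (k j : ℝ)) m
  simp only [hinj] at h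
  rwa [cubeCoeff_mFourier]

/-- If the columns `p₁, …, pₙ` of `P` are `ℚ`-linearly independent, `F : 𝕋ⁿ → ℂ` is
continuous, and `f(x) = F(Pᵀx mod ℤⁿ)`, then for every `λ ∈ ℝᵈ` not of the form `Pk`
with `k ∈ ℤⁿ`, the Bohr–Fourier coefficient of `f` at `λ` exists and vanishes;
consequently the Bohr spectrum of `f` (the set of frequencies whose Bohr–Fourier
coefficient exists and is nonzero) equals `P(Σ_F)`, where `Σ_F` is the set of
`k ∈ ℤⁿ` with `F̂(k) ≠ 0`. -/
theorem bohr_spectrum_eq_image_fourier_spectrum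
    (d n : ℕ) (hd : 1 ≤ d) (hn : 1 ≤ n)
    (P : Matrix (Fin d) (Fin n) ℝ)
    (hP : ∀ r : Fin n → ℚ, (∀ i : Fin d, ∑ j : Fin n, (r j : ℝ) * P i j = 0) → r = 0)
    (F : (Fin n → AddCircle (1 : ℝ)) → ℂ) (hF : Continuous F)
    (f : (Fin d → ℝ) → ℂ)
    (hf : ∀ x : Fin d → ℝ,
      f x = F (fun j : Fin n => ((∑ i : Fin d, P i j * x i : ℝ) : AddCircle (1 : ℝ))))
    (coefAvg : (Fin d → ℝ) → ℝ → ℂ)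
    (hcoefAvg : ∀ (lam : Fin d → ℝ) (T : ℝ),
      coefAvg lam T = ((2 * T) ^ d)⁻¹ •
        ∫ x in Set.Icc (fun _ : Fin d => -T) (fun _ : Fin d => T),
          f x * Complex.exp (-2 * (Real.pi : ℂ) * Complex.I *
            ((∑ i : Fin d, lam i * x i : ℝ) : ℂ)))
    (Fhat : (Fin n → ℤ) → ℂ)
    (hFhat : ∀ k : Fin n → ℤ,
      Fhat k = ∫ y in Set.Icc (0 : Fin n → ℝ) 1,
        F (fun j : Fin n => ((y j : ℝ) : AddCircle (1 : ℝ))) *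
          Complex.exp (-2 * (Real.pi : ℂ) * Complex.I *
            ((∑ j : Fin n, (k j : ℝ) * y j : ℝ) : ℂ))) :
    (∀ lam : Fin d → ℝ,
      (∀ k : Fin n → ℤ, lam ≠ fun i : Fin d => ∑ j : Fin n, P i j * (k j : ℝ)) →
      Tendsto (coefAvg lam) atTop (nhds 0)) ∧
    {lam : Fin d → ℝ | ∃ c : ℂ, c ≠ 0 ∧ Tendsto (coefAvg lam) atTop (nhds c)}
      = (fun k : Fin n → ℤ => fun i : Fin d => ∑ j : Fin n, P i j * (k j : ℝ)) ''
          {k : Fin n → ℤ | Fhat k ≠ 0} := by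
  have havg (lam : Fin d → ℝ) : coefAvg lam = fun T => bohrAverage P lam T ⟨F, hF⟩ := by
    funext T
    rw [hcoefAvg, real_smul]
    simp only [bohrAverage, twistedIntegral, LinearMap.coe_mk, AddHom.coe_mk,
      ContinuousMap.coe_mk, hf]
    push_cast
    rfl
  have hcoeff (k : Fin n → ℤ) : Fhat k = cubeCoeff k ⟨F, hF⟩ := by
    rw [hFhat]
    simp only [cubeCoeff, twistedIntegral, LinearMap.coe_mk, AddHom.coe_mk,
      ContinuousMap.coe_mk, one_mul]
  have hzero (lam : Fin d → ℝ)
      (h : ∀ k : Fin n → ℤ, lam ≠ fun i : Fin d => ∑ j : Fin n, P i j * (k j : ℝ)) :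
      Tendsto (coefAvg lam) atTop (nhds 0) := by
    rw [havg]
    exact tendsto_bohrAverage_zero P lam h _
  have hlim (k : Fin n → ℤ) :
      Tendsto (coefAvg fun i => ∑ j, P i j * (k j : ℝ)) atTop (nhds (Fhat k)) := by
    rw [havg, hcoeff]
    exact tendsto_bohrAverage_cubeCoeff P hP k _
  refine ⟨hzero, Set.ext fun lam => ⟨?_, ?_⟩⟩
  · rintro ⟨c, hc, hlam⟩
    by_cases h : ∃ k : Fin n → ℤ, lam = fun i : Fin d => ∑ j : Fin n, P i j * (k j : ℝ)
    · obtain ⟨k, rfl⟩ := h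
      refine ⟨k, ?_, rfl⟩
      rw [Set.mem_ofPred_eq, tendsto_nhds_unique (hlim k) hlam]
      exact hc
    · push Not at h
      exact absurd (tendsto_nhds_unique hlam (hzero lam h)) hc
  · rintro ⟨k, hk, rfl⟩
    exact ⟨Fhat k, hk, hlim k⟩
end

section
/- The series ∑_{(n,m)∈B, (n,m)≠(0,0)} |n+φm|^{-3/2} converges, and the function f : ℝ → ℂ defined by f(x) = ∑_{(n,m)∈B, (n,m)≠(0,0)} |n+φm|^{-3/2} e^{2πi(n+φ'm)x} is well defined (the series converges absolutely and uniformly) and is infinitely differentiable on ℝ. -/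
open Complex

/-- The iterated derivatives of `x ↦ a * exp (c * x)` along the real line. -/
lemma iteratedDeriv_const_mul_cexp_const_mul_ofReal (a c : ℂ) (k : ℕ) :
    iteratedDeriv k (fun x : ℝ => a * exp (c * (x : ℂ))) =
      fun x : ℝ => a * c ^ k * exp (c * (x : ℂ)) := by
  induction k with
  | zero => simp
  | succ k ih =>
    rw [iteratedDeriv_succ, ih]
    funext x
    have h : HasDerivAt (fun x : ℝ => c * (x : ℂ)) (c * 1) x :=
      (HasDerivAt.ofReal_comp (hasDerivAt_id x)).const_mul c
    rw [(h.cexp.const_mul (a * c ^ k)).deriv]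
    ring

/-- A trigonometric series with summable coefficients and uniformly bounded frequencies is
smooth. -/
lemma contDiff_tsum_mul_cexp_of_bounded {ι : Type*} {a t : ι → ℝ} {C : ℝ}
    (ha : Summable a) (ha0 : ∀ i, 0 ≤ a i) (ht : ∀ i, |t i| ≤ C) :
    ContDiff ℝ (⊤ : ℕ∞) (fun x : ℝ => ∑' i,
      ((a i : ℝ) : ℂ) * exp (2 * (Real.pi : ℂ) * I * (t i : ℂ) * (x : ℂ))) := by
  refine contDiff_tsum (v := fun k i => a i * (2 * Real.pi * C) ^ k) ?_
    (fun k _ => ha.mul_right _) ?_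
  · intro i
    have h : ContDiff ℝ (⊤ : ℕ∞) (fun x : ℝ => (x : ℂ)) := ofRealCLM.contDiff
    exact contDiff_const.mul (contDiff_const.mul h).cexp
  · intro k i x _
    rw [norm_iteratedFDeriv_eq_norm_iteratedDeriv,
      iteratedDeriv_const_mul_cexp_const_mul_ofReal]
    have h : 2 * (Real.pi : ℂ) * I * (t i : ℂ) * (x : ℂ)
        = ((2 * Real.pi * t i * x : ℝ) : ℂ) * I := by push_cast; ring
    rw [norm_mul, norm_mul, norm_pow, h, norm_exp_ofReal_mul_I, mul_one]
    simp only [norm_mul, norm_real, norm_I, Real.norm_eq_abs, abs_of_nonneg (ha0 i),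
      abs_of_pos Real.pi_pos, mul_one, RCLike.norm_ofNat]
    gcongr
    · exact ha0 i
    · exact ht i

/-- If `n + mφ'` is bounded by `C` and `(n, m) ≠ 0`, then `n + φm` is bounded below by a
multiple of `1 + |m|`. -/
lemma one_add_abs_le_mul_abs_add_goldenRatio_mul {C : ℝ} (hC : 1 ≤ C) {n m : ℤ}
    (hb : |(n : ℝ) + m * Real.goldenConj| ≤ C) (h0 : (n, m) ≠ 0) :
    1 + |(m : ℝ)| ≤ (1 + C + C ^ 2) * |(n : ℝ) + Real.goldenRatio * m| := by
  set x := (n : ℝ) + Real.goldenRatio * m with hx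
  set y := (n : ℝ) + m * Real.goldenConj with hy
  have hN : x * y = ((n ^ 2 + n * m - m ^ 2 : ℤ) : ℝ) := by
    push_cast
    linear_combination (n : ℝ) * m * Real.goldenRatio_add_goldenConj
      + (m : ℝ) ^ 2 * Real.goldenRatio_mul_goldenConj
  have irr : ∀ r : ℝ, Irrational r → (n : ℝ) + r * m ≠ 0 := by
    intro r hr h
    by_cases hm : m = 0
    · subst hm
      simp only [Int.cast_zero, mul_zero, add_zero, Int.cast_eq_zero] at h
      exact h0 (by simp [h])
    · exact ((hr.mul_intCast hm).intCast_add n).ne_zero h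
  have hx0 : x ≠ 0 := irr _ Real.goldenRatio_irrational
  have hy0 : y ≠ 0 := by
    have := irr _ Real.goldenConj_irrational
    rwa [mul_comm] at this
  have h1 : 1 ≤ |x| * |y| := by
    have hne : n ^ 2 + n * m - m ^ 2 ≠ 0 := by
      intro h
      rw [h, Int.cast_zero] at hN
      exact (mul_ne_zero hx0 hy0) hN
    rw [← abs_mul, hN, ← Int.cast_abs]
    exact_mod_cast Int.one_le_abs hne
  have h2 : 1 ≤ C * |x| := by nlinarith [abs_nonneg x]
  have h3 : |(m : ℝ)| ≤ |x| + C := by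
    have e : x - y = Real.sqrt 5 * m := by
      rw [← Real.goldenRatio_sub_goldenConj]; ring
    have h5 : 1 ≤ Real.sqrt 5 := Real.one_le_sqrt.mpr (by norm_num)
    have h6 : Real.sqrt 5 * |(m : ℝ)| ≤ |x| + |y| := by
      rw [← abs_of_nonneg (Real.sqrt_nonneg 5), ← abs_mul, ← e]
      exact abs_sub x y
    nlinarith [abs_nonneg (m : ℝ)]
  nlinarith

/-- A function of the second coordinate that is summable over `ℤ` is summable over the integer
points of a strip around a line transverse to the first axis. -/
lemma summable_strip {g : ℤ → ℝ} (hg : Summable g) (r C : ℝ) {s : Set (ℤ × ℤ)}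
    (hs : ∀ p ∈ s, |(p.1 : ℝ) + p.2 * r| ≤ C) :
    Summable (fun p : s => g (p : ℤ × ℤ).2) := by
  let F : Finset ℤ := Finset.Icc (-⌈C + 1⌉) ⌈C + 1⌉
  have hF : ∀ p : s, (p : ℤ × ℤ).1 + ⌊((p : ℤ × ℤ).2 : ℝ) * r⌋ ∈ F := by
    intro p
    have hp := abs_le.mp (hs p p.2)
    have h1 := Int.floor_le (((p : ℤ × ℤ).2 : ℝ) * r)
    have h2 := Int.lt_floor_add_one (((p : ℤ × ℤ).2 : ℝ) * r)
    have h3 := Int.le_ceil (C + 1)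
    rw [Finset.mem_Icc]
    constructor
    · have : (-⌈C + 1⌉ : ℝ) ≤ (p : ℤ × ℤ).1 + ⌊((p : ℤ × ℤ).2 : ℝ) * r⌋ := by linarith
      exact_mod_cast this
    · have : ((p : ℤ × ℤ).1 : ℝ) + ⌊((p : ℤ × ℤ).2 : ℝ) * r⌋ ≤ ⌈C + 1⌉ := by linarith
      exact_mod_cast this
  have hsum : Summable (fun q : F × ℤ => g q.2) := by
    simpa using (summable_mul_of_summable_norm (f := fun _ : F => (1 : ℝ)) (g := g)
      (Summable.of_finite) hg.norm)
  refine hsum.comp_injective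
    (i := fun p : s => (⟨_, hF p⟩, (p : ℤ × ℤ).2)) ?_
  rintro ⟨⟨n, m⟩, hp⟩ ⟨⟨n', m'⟩, hp'⟩ h
  simp only [Prod.mk.injEq, Subtype.mk.injEq] at h
  obtain ⟨h1, rfl⟩ := h
  have : n = n' := by linarith
  subst this
  rfl

/-- The series `∑ (1 + |m|)^{-s}` over the integers converges for `s > 1`. -/
lemma summable_one_add_abs_int_rpow {s : ℝ} (hs : 1 < s) :
    Summable (fun m : ℤ => (1 + |(m : ℝ)|) ^ (-s)) := by
  have h : Summable (fun n : ℕ => (1 + (n : ℝ)) ^ (-s)) := by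
    have := (summable_nat_add_iff 1).mpr (Real.summable_nat_rpow.mpr (neg_lt_neg hs))
    simpa [add_comm] using this
  exact Summable.of_nat_of_neg (by simpa using h) (by simpa using h)

/-- **A smooth quasi-periodic function from the golden-ratio cut-and-project scheme.**
With `φ = (1+√5)/2`, `φ' = (1−√5)/2`, a bounded interval `W` with nonempty interior,
and `B = {(n,m) ∈ ℤ² : n + mφ' ∈ W}`, the series `∑_{(n,m)∈B∖{0}} |n+φm|^{-3/2}`
converges, and the function `f(x) = ∑_{(n,m)∈B∖{0}} |n+φm|^{-3/2} e^{2πi(n+φ'm)x}`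
is well defined and infinitely differentiable on `ℝ`. -/
theorem golden_ratio_smooth_quasiperiodic
    (gr gr' : ℝ) (hgr : gr = (1 + Real.sqrt 5) / 2) (hgr' : gr' = (1 - Real.sqrt 5) / 2)
    (W : Set ℝ) (hWbdd : Bornology.IsBounded W) (hWint : W.OrdConnected)
    (hWne : (interior W).Nonempty)
    (B : Set (ℤ × ℤ)) (hB : B = {p : ℤ × ℤ | (p.1 : ℝ) + (p.2 : ℝ) * gr' ∈ W}) :
    Summable (fun p : {p : ℤ × ℤ // p ∈ B ∧ p ≠ 0} =>
      |((p : ℤ × ℤ).1 : ℝ) + gr * ((p : ℤ × ℤ).2 : ℝ)| ^ (-(3 / 2) : ℝ)) ∧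
    ContDiff ℝ (⊤ : ℕ∞) (fun x : ℝ => ∑' p : {p : ℤ × ℤ // p ∈ B ∧ p ≠ 0},
      ((|((p : ℤ × ℤ).1 : ℝ) + gr * ((p : ℤ × ℤ).2 : ℝ)| ^ (-(3 / 2) : ℝ) : ℝ) : ℂ) *
        Complex.exp (2 * (Real.pi : ℂ) * Complex.I *
          ((((p : ℤ × ℤ).1 : ℝ) + gr' * ((p : ℤ × ℤ).2 : ℝ)) : ℂ) * (x : ℂ))) := by
  obtain rfl : gr = Real.goldenRatio := hgr
  obtain rfl : gr' = Real.goldenConj := hgr'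
  obtain ⟨C₀, hC₀⟩ := isBounded_iff_forall_norm_le.mp hWbdd
  obtain ⟨C, hC1, hC⟩ : ∃ C : ℝ, 1 ≤ C ∧
      ∀ p ∈ B, |(p.1 : ℝ) + p.2 * Real.goldenConj| ≤ C := by
    refine ⟨max 1 C₀, le_max_left _ _, fun p hp => ?_⟩
    rw [hB] at hp
    exact (hC₀ _ hp).trans (le_max_right _ _)
  have hsum : Summable (fun p : {p : ℤ × ℤ // p ∈ B ∧ p ≠ 0} =>
      |((p : ℤ × ℤ).1 : ℝ) + Real.goldenRatio * ((p : ℤ × ℤ).2 : ℝ)| ^ (-(3 / 2) : ℝ)) := by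
    have hg := summable_strip (s := {p : ℤ × ℤ | p ∈ B ∧ p ≠ 0})
      (summable_one_add_abs_int_rpow (s := 3 / 2) (by norm_num)) Real.goldenConj C
      (fun p hp => hC p hp.1)
    refine Summable.of_nonneg_of_le (fun p => by positivity) ?_
      (hg.mul_left ((1 + C + C ^ 2) ^ (3 / 2 : ℝ)))
    rintro ⟨⟨n, m⟩, hp, hp0⟩
    have key := one_add_abs_le_mul_abs_add_goldenRatio_mul hC1 (hC _ hp) hp0
    have hK : 0 < 1 + C + C ^ 2 := by positivity
    have hm : 0 < 1 + |(m : ℝ)| := by positivity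
    have h := Real.rpow_le_rpow_of_nonpos hm key (by norm_num : (-(3 / 2) : ℝ) ≤ 0)
    rw [Real.mul_rpow hK.le (abs_nonneg _), Real.rpow_neg hK.le] at h
    exact (inv_mul_le_iff₀ (by positivity)).mp h
  refine ⟨hsum, ?_⟩
  have h := contDiff_tsum_mul_cexp_of_bounded (C := C)
    (t := fun p : {p : ℤ × ℤ // p ∈ B ∧ p ≠ 0} => ((p : ℤ × ℤ).1 : ℝ) + Real.goldenConj * ((p : ℤ × ℤ).2 : ℝ))
    hsum (fun p => by positivity)
    (fun p => by rw [mul_comm]; exact hC _ p.2.1)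
  simpa only [ofReal_add, ofReal_mul] using h
end

section
/- The series ∑_{(n,m)∈B, (n,m)≠(0,0)} (n² + m²)/|n+φm|³ diverges to +∞. (Consequently the ℤ²-periodic parent function F(y₁,y₂) = ∑_{(n,m)∈B,(n,m)≠(0,0)} |n+φm|^{-3/2} e^{2πi(ny₁+my₂)} cannot be continuously differentiable on 𝕋².) -/
/-- Powers of `1 + x`, for `x` a root of `x² = x + 1`, have positive integer coordinates
with respect to `1, x`. -/
lemma exists_pos_coords_one_add_pow {x : ℝ} (hx : x ^ 2 = x + 1) (N : ℕ) :
    ∃ A G : ℤ, 0 < A ∧ 0 < G ∧ (A : ℝ) + G * x = (1 + x) ^ (N + 1) := by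
  induction N with
  | zero => exact ⟨1, 1, by norm_num, by norm_num, by push_cast; ring⟩
  | succ N ih =>
    obtain ⟨A, G, hA, hG, h⟩ := ih
    refine ⟨A + G, A + 2 * G, by omega, by omega, ?_⟩
    rw [pow_succ, ← h]
    push_cast
    linear_combination (-(G : ℝ)) * hx

/-- If `A + G x` is positive and smaller than `b - a` with `G > 0`, then the integers `m` for which
some `n + m x` lies in `(a, b)` have bounded gaps. -/
lemma exists_bounded_gap {x a b : ℝ} {A G : ℤ} (hG : 0 < G) (hpos : 0 < (A : ℝ) + G * x)
    (hlt : (A : ℝ) + G * x < b - a) :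
    ∃ K : ℤ, 0 < K ∧ ∀ M : ℤ, ∃ n m : ℤ, M < m ∧ m ≤ M + K ∧ (n : ℝ) + m * x ∈ Set.Ioo a b := by
  set u : ℝ := (A : ℝ) + G * x with hu
  have hfl : 0 ≤ ⌊1 / u⌋ := Int.floor_nonneg.2 (by positivity)
  refine ⟨G * (⌊1 / u⌋ + 1), by positivity, fun M => ?_⟩
  set t : ℝ := a - M * x with ht
  set j : ℤ := ⌊Int.fract t / u⌋ + 1 with hj
  have hs0 := Int.fract_nonneg t
  have hs1 := Int.fract_lt_one t
  have hj1 : 1 ≤ j := by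
    have : 0 ≤ ⌊Int.fract t / u⌋ := Int.floor_nonneg.2 (by positivity)
    omega
  have hjK : j ≤ ⌊1 / u⌋ + 1 := by
    have : ⌊Int.fract t / u⌋ ≤ ⌊1 / u⌋ := Int.floor_le_floor (by gcongr)
    omega
  have hlow : Int.fract t < j * u := by
    rw [← div_lt_iff₀ hpos, hj]
    push_cast
    exact Int.lt_floor_add_one _
  have hupp : j * u ≤ Int.fract t + u := by
    have h := (le_div_iff₀ hpos).1 (Int.floor_le (Int.fract t / u))
    rw [hj]
    push_cast
    linarith
  have hval : ((⌊t⌋ + j * A : ℤ) : ℝ) + ((M + j * G : ℤ) : ℝ) * x = a - Int.fract t + j * u := by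
    have h := Int.floor_add_fract t
    push_cast
    rw [hu]
    linear_combination h + ht
  refine ⟨⌊t⌋ + j * A, M + j * G, by nlinarith, by nlinarith, ?_⟩
  rw [hval]
  constructor <;> linarith

/-- A point `(n, m)` whose conjugate `n + m φ'` is smaller in absolute value than `m`
contributes at least `1 / (64 m)` to the series. -/
lemma one_div_le_term {n m r s R : ℝ} (hr : r = (1 + Real.sqrt 5) / 2)
    (hs : s = (1 - Real.sqrt 5) / 2) (hR : |n + m * s| ≤ R) (hm : R < m) :
    1 / (64 * m) ≤ (n ^ 2 + m ^ 2) / |n + r * m| ^ 3 := by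
  obtain ⟨h1, h2⟩ := abs_le.1 hR
  have hm0 : 0 < m := ((abs_nonneg _).trans hR).trans_lt hm
  have h5l : 2 < Real.sqrt 5 := Real.lt_sqrt_of_sq_lt (by norm_num)
  have h5u : Real.sqrt 5 < 3 := (Real.sqrt_lt' (by norm_num)).2 (by norm_num)
  have heq : n + r * m = (n + m * s) + Real.sqrt 5 * m := by rw [hr, hs]; ring
  have hpos : 0 < n + r * m := by rw [heq]; nlinarith
  have hle : n + r * m ≤ 4 * m := by rw [heq]; nlinarith
  rw [abs_of_pos hpos]
  calc 1 / (64 * m) = m ^ 2 / (4 * m) ^ 3 := by field_simp; norm_num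
    _ ≤ (n ^ 2 + m ^ 2) / (n + r * m) ^ 3 := by
      gcongr
      exact le_add_of_nonneg_left (sq_nonneg n)


/-- **Divergence of the derivative series for the parent function.**
With `φ = (1+√5)/2`, `φ' = (1−√5)/2`, a bounded interval `W` with nonempty interior,
and `B = {(n,m) ∈ ℤ² : n + mφ' ∈ W}`, the series
`∑_{(n,m)∈B∖{0}} (n² + m²)/|n+φm|³` diverges (it is a series of nonnegative terms
which is not summable). -/
theorem golden_ratio_parent_series_diverges
    (gr gr' : ℝ) (hgr : gr = (1 + Real.sqrt 5) / 2) (hgr' : gr' = (1 - Real.sqrt 5) / 2)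
    (W : Set ℝ) (hWbdd : Bornology.IsBounded W) (hWint : W.OrdConnected)
    (hWne : (interior W).Nonempty)
    (B : Set (ℤ × ℤ)) (hB : B = {p : ℤ × ℤ | (p.1 : ℝ) + (p.2 : ℝ) * gr' ∈ W}) :
    ¬ Summable (fun p : {p : ℤ × ℤ // p ∈ B ∧ p ≠ 0} =>
      ((((p : ℤ × ℤ).1 : ℝ) ^ 2 + ((p : ℤ × ℤ).2 : ℝ) ^ 2) /
        |((p : ℤ × ℤ).1 : ℝ) + gr * ((p : ℤ × ℤ).2 : ℝ)| ^ 3)) := by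

  have h5l : 2 < Real.sqrt 5 := Real.lt_sqrt_of_sq_lt (by norm_num)
  have h5u : Real.sqrt 5 < 3 := (Real.sqrt_lt' (by norm_num)).2 (by norm_num)
  have hquad : gr' ^ 2 = gr' + 1 := by
    rw [hgr']
    linear_combination (1 / 4 : ℝ) * Real.sq_sqrt (show (0 : ℝ) ≤ 5 by norm_num)
  obtain ⟨c, hc⟩ := hWne
  obtain ⟨ε, hε, hball⟩ := Metric.mem_nhds_iff.1 (mem_interior_iff_mem_nhds.1 hc)
  rw [Real.ball_eq_Ioo] at hball
  obtain ⟨N, hN⟩ := exists_pow_lt_of_lt_one hε (show 1 + gr' < 1 by rw [hgr']; linarith)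
  have hbase : 0 < 1 + gr' := by rw [hgr']; linarith
  obtain ⟨A, G, -, hG, hAG⟩ := exists_pos_coords_one_add_pow hquad N
  have hAGpos : 0 < (A : ℝ) + G * gr' := by rw [hAG]; positivity
  have hAGlt : (A : ℝ) + G * gr' < (c + ε) - (c - ε) := by
    have : (1 + gr') ^ (N + 1) ≤ (1 + gr') ^ N :=
      pow_le_pow_of_le_one hbase.le (by rw [hgr']; linarith) (Nat.le_succ N)
    rw [hAG]
    linarith
  obtain ⟨K, hK, hgap⟩ := exists_bounded_gap hG hAGpos hAGlt
  obtain ⟨R, hR0, hR⟩ := hWbdd.exists_pos_norm_le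
  obtain ⟨L, hL⟩ := exists_nat_gt R
  choose n m hlo hhi hmem using fun i : ℕ => hgap (((i : ℤ) + L) * K)
  have hm0 : ∀ i, (L : ℤ) < m i := fun i => by
    have : (i : ℤ) + L ≤ (i + L) * K := le_mul_of_one_le_right (by positivity) hK
    have := hlo i
    omega
  have hmR : ∀ i, R < m i := fun i => hL.trans (by exact_mod_cast hm0 i)
  have hB' : ∀ i, (n i, m i) ∈ B ∧ (n i, m i) ≠ 0 := fun i => by
    refine ⟨hB ▸ hball (hmem i), fun h => ?_⟩
    have h2 : m i = 0 := congrArg Prod.snd h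
    have := hm0 i
    omega
  have hmono : StrictMono m := strictMono_nat_of_lt_succ fun i => by
    have h1 := hhi i
    have h2 := hlo (i + 1)
    push_cast at h2
    linarith
  intro hsum
  have hinj : Function.Injective fun i => (⟨(n i, m i), hB' i⟩ : {p : ℤ × ℤ // p ∈ B ∧ p ≠ 0}) :=
    fun i j h => hmono.injective (congrArg (fun p => p.1.2) h)
  have hK' : (0 : ℝ) < K := by exact_mod_cast hK
  have hsum' : Summable fun i : ℕ => 1 / (64 * K : ℝ) * (1 / ((i + (L + 1) : ℕ) : ℝ)) := by
    refine Summable.of_nonneg_of_le (fun i => by positivity) (fun i => ?_)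
      (hsum.comp_injective hinj)
    refine le_trans ?_ (one_div_le_term hgr hgr' (hR _ (hball (hmem i))) (hmR i))
    have hmpos : (0 : ℝ) < m i := hR0.trans (hmR i)
    have hmle : (m i : ℝ) ≤ K * ((i + (L + 1) : ℕ) : ℝ) := by
      have h : (m i : ℝ) ≤ ((i : ℝ) + L) * K + K := by exact_mod_cast hhi i
      push_cast
      linarith
    rw [one_div_mul_one_div, mul_assoc]
    gcongr
  rw [summable_mul_left_iff (by positivity)] at hsum'
  exact Real.not_summable_one_div_natCast
    ((summable_nat_add_iff (f := fun i : ℕ => 1 / (i : ℝ)) (L + 1)).1 hsum')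
end

section
/- Let p₁,…,pₙ be ℚ-linearly independent real numbers, let F : ℝⁿ → ℂ be continuous and ℤⁿ-periodic, and let f : ℝ → ℂ be defined by f(x) = F(p₁x, p₂x, …, pₙx). Suppose: (a) there exist an integer r > n and a real number 0 < η < 1 such that f is r-times continuously differentiable and the r-th derivative f^{(r)} is η-Hölder continuous (i.e., there is K > 0 with |f^{(r)}(x) − f^{(r)}(y)| ≤ K|x−y|^η for all x, y ∈ ℝ); (b) there exists D' > 0 such that for every k = (k₁,…,kₙ) ∈ ℤⁿ with F̂(k) ≠ 0 one has |k₁p₁+⋯+kₙpₙ| ≥ D'·√(k₁²+⋯+kₙ²). Then F is (r−n)-times continuously differentiable. -/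
open MeasureTheory Complex

theorem norm_fwdDiff_iter_le (r : ℕ) : ∀ {f : ℝ → ℂ} (_ : ContDiff ℝ r f) {M : ℝ}
    (_ : ∀ x, ‖iteratedDeriv r f x‖ ≤ M) (h x : ℝ), ‖(fwdDiff h)^[r] f x‖ ≤ |h| ^ r * M := by
  induction r with
  | zero => intro f _ M hM h x; simpa using hM x
  | succ r ih =>
    intro f hf M hM h x
    have hf' : ContDiff ℝ r f := hf.of_le (by norm_cast; omega)
    have hs : ContDiff ℝ r (fun y => f (y + h)) := hf'.comp (contDiff_id.add contDiff_const)
    have key : ∀ y, ‖iteratedDeriv r (fwdDiff h f) y‖ ≤ |h| * M := by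
      intro y
      have e : iteratedDeriv r (fwdDiff h f) y = iteratedDeriv r f (y + h) - iteratedDeriv r f y := by
        have : fwdDiff h f = (fun y => f (y + h)) - f := rfl
        rw [this, iteratedDeriv_sub hs.contDiffAt hf'.contDiffAt, iteratedDeriv_comp_add_const]
      rw [e]
      have hd : Differentiable ℝ (iteratedDeriv r f) :=
        hf.differentiable_iteratedDeriv r (by norm_cast; omega)
      have := Convex.norm_image_sub_le_of_norm_deriv_le (f := iteratedDeriv r f) (s := Set.univ)
        (x := y) (y := y + h) (C := M) (fun z _ => hd z)
        (fun z _ => by rw [← iteratedDeriv_succ]; exact hM z) convex_univ trivial trivial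
      simpa [mul_comm] using this
    rw [Function.iterate_succ_apply]
    have hc : ContDiff ℝ r (fwdDiff h f) := hs.sub hf'
    calc _ ≤ _ := ih hc key h x
      _ = _ := by ring

theorem summable_norm_rpow_intLattice (n : ℕ) {s : ℝ} (hs : s < -n) :
    Summable fun k : Fin n → ℤ => ‖k‖ ^ s := by
  let L : Submodule ℤ (Fin n → ℝ) := Submodule.span ℤ (Set.range (Pi.basisFun ℝ (Fin n)))
  have hmem (k : Fin n → ℤ) : (fun j => (k j : ℝ)) ∈ L :=
    ((Pi.basisFun ℝ (Fin n)).mem_span_iff_repr_mem ℤ _).2 fun i => ⟨k i, by simp⟩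
  have hr : Module.finrank ℤ L = n := by
    rw [ZLattice.rank ℝ L]; simp
  have h1 := ZLattice.summable_norm_rpow L s (by rw [hr]; exact hs)
  have hinj : Function.Injective (fun k : Fin n → ℤ => (⟨_, hmem k⟩ : L)) := by
    intro k l hkl
    ext j
    have := congrFun (congrArg Subtype.val hkl) j
    simpa using this
  refine (h1.comp_injective hinj).congr fun k => ?_
  simp only [Function.comp]
  congr 1

theorem norm_iteratedFDeriv_cexp_comp_le {E : Type*} [NormedAddCommGroup E] [NormedSpace ℝ E]
    (L : E →L[ℝ] ℝ) (m : ℕ) (c : ℂ) (x : E) :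
    ‖iteratedFDeriv ℝ m (fun y => Complex.exp (c * (L y : ℝ))) x‖ ≤
      (‖c‖ * ‖L‖) ^ m * ‖Complex.exp (c * (L x : ℝ))‖ := by
  let g : ℝ → ℂ := fun t => Complex.exp (c * (t : ℝ))
  have hg : ContDiff ℝ m g :=
    (contDiff_const.mul Complex.ofRealCLM.contDiff).cexp
  have hd : iteratedDeriv m g = fun t => c ^ m * g t := by
    clear hg
    induction m with
    | zero => simp
    | succ m ih =>
      rw [iteratedDeriv_succ, ih]
      funext t
      have h1 : HasDerivAt (fun t : ℝ => c * (t : ℂ)) c t := by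
        simpa using (Complex.ofRealCLM.hasDerivAt (x := t)).const_mul c
      have h2 : HasDerivAt g (g t * c) t := h1.cexp
      rw [(h2.const_mul (c ^ m)).deriv]
      ring
  have := L.iteratedFDeriv_comp_right hg x (i := m) le_rfl
  have e : (fun y => Complex.exp (c * (L y : ℝ))) = g ∘ L := rfl
  rw [e, this]
  refine (ContinuousMultilinearMap.norm_compContinuousLinearMap_le _ _).trans ?_
  rw [norm_iteratedFDeriv_eq_norm_iteratedDeriv, hd]
  simp [g, mul_pow]
  exact le_of_eq (by ring)

noncomputable local instance : MeasureSpace UnitAddCircle := ⟨AddCircle.haarAddCircle⟩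

local instance : Measure.IsAddHaarMeasure (volume : Measure UnitAddCircle) :=
  inferInstanceAs (Measure.IsAddHaarMeasure AddCircle.haarAddCircle)

local instance : IsProbabilityMeasure (volume : Measure UnitAddCircle) :=
  inferInstanceAs (IsProbabilityMeasure AddCircle.haarAddCircle)

open UnitAddTorus

theorem mFourier_coe_s13 {n : ℕ} (k : Fin n → ℤ) (y : Fin n → ℝ) :
    mFourier k (fun j => (y j : UnitAddCircle)) =
      Complex.exp (2 * Real.pi * Complex.I * ((∑ j, (k j : ℝ) * y j : ℝ) : ℂ)) := by
  simp only [mFourier, ContinuousMap.coe_mk, fourier_coe_apply, ← Complex.exp_sum]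
  congr 1
  push_cast
  rw [Finset.mul_sum]
  refine Finset.sum_congr rfl fun j _ => ?_
  ring

theorem mFourier_apply_add {n : ℕ} (k : Fin n → ℤ) (s t : UnitAddTorus (Fin n)) :
    mFourier k (t + s) = mFourier k t * mFourier k s := by
  simp [mFourier, ← Finset.prod_mul_distrib, fourier_apply, smul_add, AddCircle.toCircle_add]

theorem norm_mFourier_apply {n : ℕ} (k : Fin n → ℤ) (t : UnitAddTorus (Fin n)) :
    ‖mFourier k t‖ = 1 := by
  simp only [mFourier, ContinuousMap.coe_mk, norm_prod, fourier_apply, Circle.norm_coe,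
    Finset.prod_const_one]

theorem mFourierCoeff_comp_add {n : ℕ} (g : UnitAddTorus (Fin n) → ℂ) (s : UnitAddTorus (Fin n))
    (k : Fin n → ℤ) :
    mFourierCoeff (fun t => g (t + s)) k = mFourier k s * mFourierCoeff g k := by
  have h1 : mFourier k s * mFourier (-k) s = 1 := by
    rw [← mFourier_add, add_neg_cancel, mFourier_zero]; rfl
  unfold mFourierCoeff
  rw [← integral_add_right_eq_self (fun t => mFourier (-k) t • g t) s, ← integral_const_mul]
  congr 1
  funext t
  simp only [mFourier_apply_add, smul_eq_mul]
  linear_combination (- mFourier (-k) t * g (t + s)) * h1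

theorem integrable_continuousMap {n : ℕ} (g : C(UnitAddTorus (Fin n), ℂ)) :
    Integrable g (volume : Measure (UnitAddTorus (Fin n))) := by
  exact g.continuous.integrable_of_hasCompactSupport (HasCompactSupport.of_compactSpace g)

/-- Time averages along a nonresonant linear flow on the torus converge to the space average,
for trigonometric polynomials. -/
theorem tendsto_average_of_mem_span {n : ℕ} {p : Fin n → ℝ}
    (hp : ∀ k : Fin n → ℤ, ∑ j, (k j : ℝ) * p j = 0 → k = 0)
    {P : C(UnitAddTorus (Fin n), ℂ)}
    (hP : P ∈ Submodule.span ℂ (Set.range (mFourier (d := Fin n)))) :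
    Filter.Tendsto (fun T : ℝ => (T : ℂ)⁻¹ *
        ∫ x in (0 : ℝ)..T, P (fun j => ((p j * x : ℝ) : UnitAddCircle)))
      Filter.atTop (nhds (∫ t, P t)) := by
  have hline : Continuous fun x : ℝ => (fun j => ((p j * x : ℝ) : UnitAddCircle)) :=
    continuous_pi fun j => (AddCircle.continuous_mk' 1).comp (continuous_const.mul continuous_id)
  have hint (P : C(UnitAddTorus (Fin n), ℂ)) (T : ℝ) : IntervalIntegrable
      (fun x : ℝ => P (fun j => ((p j * x : ℝ) : UnitAddCircle))) volume 0 T :=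
    (P.continuous.comp hline).intervalIntegrable _ _
  induction hP using Submodule.span_induction with
  | mem P h =>
    obtain ⟨k, rfl⟩ := h
    by_cases hk : k = 0
    · subst hk
      simp only [mFourier_zero, ContinuousMap.one_apply]
      refine tendsto_const_nhds.congr' ?_
      filter_upwards [Filter.eventually_gt_atTop 0] with T hT
      have : (T : ℂ) ≠ 0 := by exact_mod_cast hT.ne'
      simp [this]
    · set ω : ℝ := ∑ j, (k j : ℝ) * p j with hω
      have hω0 : ω ≠ 0 := fun h => hk (hp k h)
      have hval (x : ℝ) : mFourier k (fun j => ((p j * x : ℝ) : UnitAddCircle)) =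
          Complex.exp ((2 * Real.pi * Complex.I * ω) * x) := by
        rw [mFourier_coe_s13, mul_assoc _ (ω : ℂ), hω, ← Complex.ofReal_mul, Finset.sum_mul]
        simp only [mul_assoc]
      have hc : (2 * Real.pi * Complex.I * ω : ℂ) ≠ 0 := by
        simp [hω0, Real.pi_ne_zero]
      have hzero : ∫ t, mFourier k t = 0 := by
        have h1 := integral_add_right_eq_self (μ := volume) (fun t => mFourier k t)
          (fun j => ((p j * (1 / (2 * ω)) : ℝ) : UnitAddCircle))
        simp only [mFourier_apply_add, hval, integral_mul_const] at h1
        have h2 : Complex.exp ((2 * Real.pi * Complex.I * ω) * ((1 / (2 * ω) : ℝ) : ℂ)) = -1 := by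
          rw [← Complex.exp_pi_mul_I]
          congr 1
          have : (ω : ℂ) ≠ 0 := by exact_mod_cast hω0
          push_cast
          field_simp
        rw [h2] at h1
        linear_combination (-1 / 2 : ℂ) * h1
      rw [hzero]
      simp only [hval]
      simp_rw [integral_exp_mul_complex hc]
      rw [tendsto_zero_iff_norm_tendsto_zero]
      have hlim : Filter.Tendsto (fun T : ℝ => T⁻¹ * (2 / ‖(2 * Real.pi * Complex.I * ω : ℂ)‖))
          Filter.atTop (nhds 0) := by
        simpa using tendsto_inv_atTop_zero.mul_const (2 / ‖(2 * Real.pi * Complex.I * ω : ℂ)‖)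
      refine squeeze_zero' (Filter.Eventually.of_forall fun _ => norm_nonneg _) ?_ hlim
      filter_upwards [Filter.eventually_gt_atTop 0] with T hT
      rw [norm_mul, norm_inv, norm_div, Complex.norm_real, Real.norm_of_nonneg hT.le]
      gcongr
      refine (norm_sub_le _ _).trans ?_
      rw [← hval, ← hval, norm_mFourier_apply, norm_mFourier_apply]
      norm_num
  | zero => simp
  | add P Q _ _ h1 h2 =>
    have := h1.add h2
    rw [← integral_add (integrable_continuousMap P) (integrable_continuousMap Q)] at this
    refine this.congr fun T => ?_
    simp only [ContinuousMap.add_apply]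
    rw [intervalIntegral.integral_add (hint P T) (hint Q T)]
    ring
  | smul a P _ h1 =>
    have := h1.const_mul a
    rw [← integral_const_mul] at this
    refine this.congr fun T => ?_
    simp only [ContinuousMap.smul_apply, smul_eq_mul, intervalIntegral.integral_const_mul]
    ring

theorem norm_integral_le_of_norm_line_le {n : ℕ} {p : Fin n → ℝ}
    (hp : ∀ k : Fin n → ℤ, ∑ j, (k j : ℝ) * p j = 0 → k = 0)
    (g : C(UnitAddTorus (Fin n), ℂ)) {M : ℝ}
    (hM : ∀ x : ℝ, ‖g (fun j => ((p j * x : ℝ) : UnitAddCircle))‖ ≤ M) :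
    ‖∫ t, g t‖ ≤ M := by
  refine le_of_forall_pos_le_add fun ε hε => ?_
  have hg : g ∈ closure (Submodule.span ℂ (Set.range (mFourier (d := Fin n))) :
      Set C(UnitAddTorus (Fin n), ℂ)) := by
    rw [← Submodule.topologicalClosure_coe, span_mFourier_closure_eq_top]; trivial
  obtain ⟨P, hP, hgP⟩ := Metric.mem_closure_iff.1 hg (ε / 2) (half_pos hε)
  have hdiff (t) : ‖g t - P t‖ ≤ ε / 2 := by
    rw [← dist_eq_norm]; exact (ContinuousMap.dist_apply_le_dist t).trans hgP.le
  have h1 : ‖∫ t, P t‖ ≤ M + ε / 2 := by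
    refine le_of_tendsto (tendsto_average_of_mem_span hp hP).norm ?_
    filter_upwards [Filter.eventually_gt_atTop 0] with T hT
    have hb := intervalIntegral.norm_integral_le_of_norm_le_const (a := 0) (b := T)
      (f := fun x : ℝ => P (fun j => ((p j * x : ℝ) : UnitAddCircle))) (C := M + ε / 2)
      (fun x _ => by
        have h1 := norm_sub_norm_le (P fun j => ((p j * x : ℝ) : UnitAddCircle))
          (g fun j => ((p j * x : ℝ) : UnitAddCircle))
        have h2 := hdiff (fun j => ((p j * x : ℝ) : UnitAddCircle))
        rw [norm_sub_rev] at h2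
        linarith [hM x])
    rw [norm_mul, norm_inv, Complex.norm_real, Real.norm_of_nonneg hT.le]
    rw [sub_zero, abs_of_pos hT] at hb
    rw [inv_mul_le_iff₀ hT]
    linarith
  have h2 : ‖(∫ t, g t) - ∫ t, P t‖ ≤ ε / 2 := by
    rw [← integral_sub (integrable_continuousMap g) (integrable_continuousMap P)]
    simpa using norm_integral_le_of_norm_le_const (μ := (volume : Measure (UnitAddTorus (Fin n))))
      (Filter.Eventually.of_forall hdiff)
  have h3 := norm_sub_norm_le (∫ t, g t) (∫ t, P t)
  linarith

theorem norm_mFourierCoeff_le_of_fwdDiff {n : ℕ} {p : Fin n → ℝ}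
    (hp : ∀ k : Fin n → ℤ, ∑ j, (k j : ℝ) * p j = 0 → k = 0)
    {G : UnitAddTorus (Fin n) → ℂ} (hG : Continuous G)
    {k : Fin n → ℤ} (hk : k ≠ 0) (m : ℕ) {M : ℝ}
    (hM : ∀ x : ℝ, ‖(fwdDiff (1 / (2 * ∑ j, (k j : ℝ) * p j)))^[m]
      (fun x : ℝ => G (fun j => ((p j * x : ℝ) : UnitAddCircle))) x‖ ≤ M) :
    2 ^ m * ‖mFourierCoeff G k‖ ≤ M := by
  induction m generalizing G with
  | zero =>
    have := norm_integral_le_of_norm_line_le hp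
      (⟨fun t => mFourier (-k) t • G t, by fun_prop⟩ : C(UnitAddTorus (Fin n), ℂ)) (M := M)
      (fun x => by
        simpa [norm_mFourier_apply] using hM x)
    simpa [mFourierCoeff] using this
  | succ m ih =>
    set ω : ℝ := ∑ j, (k j : ℝ) * p j with hω
    have hω0 : (ω : ℂ) ≠ 0 := by exact_mod_cast fun h => hk (hp k h)
    set h : ℝ := 1 / (2 * ω) with hh
    let s : UnitAddTorus (Fin n) := fun j => ((p j * h : ℝ) : UnitAddCircle)
    have hs : mFourier k s = -1 := by
      rw [mFourier_coe_s13, ← Complex.exp_pi_mul_I]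
      congr 1
      have : ∑ j, (k j : ℝ) * (p j * h) = ω * h := by
        rw [hω, Finset.sum_mul]; simp only [mul_assoc]
      rw [this, hh]
      push_cast
      field_simp
    have hGs : Continuous fun t => G (t + s) := by fun_prop
    have hint (g : UnitAddTorus (Fin n) → ℂ) (hg : Continuous g) :
        Integrable fun t => mFourier (-k) t • g t :=
      integrable_continuousMap ⟨fun t => mFourier (-k) t • g t, by fun_prop⟩
    have hcoeff : mFourierCoeff (fun t => G (t + s) - G t) k = -2 * mFourierCoeff G k := by
      have h1 : mFourierCoeff (fun t => G (t + s) - G t) k =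
          mFourierCoeff (fun t => G (t + s)) k - mFourierCoeff G k := by
        unfold mFourierCoeff
        rw [← integral_sub (hint _ hGs) (hint _ hG)]
        simp only [smul_sub]
      rw [h1, mFourierCoeff_comp_add, hs]
      ring
    have := ih (G := fun t => G (t + s) - G t) (hGs.sub hG) (fun x => by
      refine le_trans (le_of_eq ?_) (hM x)
      rw [Function.iterate_succ_apply]
      refine congrArg (fun φ => ‖(fwdDiff h)^[m] φ x‖) (funext fun y => ?_)
      simp only [fwdDiff, s, mul_add, AddCircle.coe_add]
      rfl)
    rw [hcoeff, norm_mul] at this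
    norm_num at this
    rw [pow_succ]
    linarith

theorem exists_continuous_torus_lift {n : ℕ} {F : (Fin n → ℝ) → ℂ} (hFc : Continuous F)
    (hFper : ∀ (y : Fin n → ℝ) (k : Fin n → ℤ), F (fun j => y j + (k j : ℝ)) = F y) :
    ∃ G : UnitAddTorus (Fin n) → ℂ, Continuous G ∧
      ∀ y : Fin n → ℝ, G (fun j => (y j : UnitAddCircle)) = F y := by
  have hq : IsOpenQuotientMap fun (y : Fin n → ℝ) (j : Fin n) => (y j : UnitAddCircle) :=
    IsOpenQuotientMap.piMap (f := fun _ : Fin n => ((↑) : ℝ → UnitAddCircle))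
      fun _ => QuotientAddGroup.isOpenQuotientMap_mk
  have hG (y : Fin n → ℝ) :
      F (Function.surjInv hq.surjective fun j => (y j : UnitAddCircle)) = F y := by
    set z := Function.surjInv hq.surjective fun j => (y j : UnitAddCircle) with hz
    have hzy : (fun j => (z j : UnitAddCircle)) = fun j => (y j : UnitAddCircle) :=
      Function.surjInv_eq hq.surjective _
    have hk (j : Fin n) : ∃ k : ℤ, k • (1 : ℝ) = z j - y j := by
      rw [← AddCircle.coe_eq_zero_iff, AddCircle.coe_sub, sub_eq_zero]
      exact congrFun hzy j
    choose k hk using hk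
    rw [← hFper y k]
    congr 1
    funext j
    have := hk j
    simp only [zsmul_eq_mul, mul_one] at this
    rw [this]; ring
  refine ⟨fun t => F (Function.surjInv hq.surjective t), ?_, hG⟩
  rw [hq.isQuotientMap.continuous_iff]
  exact hFc.congr fun y => (hG y).symm

theorem contDiff_of_norm_mFourierCoeff_le {n : ℕ} {G : UnitAddTorus (Fin n) → ℂ}
    (hG : Continuous G) {C s : ℝ} {N : ℕ} (hs : (n : ℝ) + N < s)
    (hC : ∀ k : Fin n → ℤ, k ≠ 0 → ‖mFourierCoeff G k‖ ≤ C * ‖k‖ ^ (-s)) :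
    ContDiff ℝ N fun y : Fin n → ℝ => G (fun j => (y j : UnitAddCircle)) := by
  have hsum (m : ℕ) (hm : m ≤ N) : Summable fun k : Fin n → ℤ =>
      ‖mFourierCoeff G k‖ * (2 * Real.pi * (n * ‖k‖)) ^ m := by
    have hm' : (m : ℝ) ≤ N := by exact_mod_cast hm
    refine Summable.of_norm_bounded_eventually
      ((summable_norm_rpow_intLattice n (s := m - s) (by linarith)).mul_left
        (C * (2 * Real.pi * n) ^ m)) ?_
    filter_upwards [(Set.finite_singleton (0 : Fin n → ℤ)).compl_mem_cofinite] with k hk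
    have hk0 : k ≠ 0 := hk
    have hpos : 0 < ‖k‖ := norm_pos_iff.2 hk0
    rw [Real.norm_of_nonneg (by positivity)]
    calc _ ≤ C * ‖k‖ ^ (-s) * (2 * Real.pi * (n * ‖k‖)) ^ m := by
          gcongr; exact hC k hk0
      _ = C * (2 * Real.pi * n) ^ m * ‖k‖ ^ (m - s) := by
          rw [sub_eq_add_neg, Real.rpow_add hpos, Real.rpow_natCast]; ring
  have hsum0 : Summable (mFourierCoeff G) :=
    Summable.of_norm (by simpa using hsum 0 (Nat.zero_le _))
  let L (k : Fin n → ℤ) : (Fin n → ℝ) →L[ℝ] ℝ :=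
    ∑ j, (k j : ℝ) • ContinuousLinearMap.proj (R := ℝ) (φ := fun _ : Fin n => ℝ) j
  have hL (k : Fin n → ℤ) (y : Fin n → ℝ) : L k y = ∑ j, (k j : ℝ) * y j := by
    simp [L]
  have hLn (k : Fin n → ℤ) : ‖L k‖ ≤ n * ‖k‖ := by
    refine ContinuousLinearMap.opNorm_le_bound _ (by positivity) fun y => ?_
    rw [hL]
    refine (norm_sum_le _ _).trans ?_
    calc _ ≤ ∑ _j : Fin n, ‖k‖ * ‖y‖ := by
          refine Finset.sum_le_sum fun j _ => ?_
          rw [norm_mul, Real.norm_eq_abs, ← Int.norm_eq_abs]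
          exact mul_le_mul (norm_le_pi_norm k j) (norm_le_pi_norm y j) (norm_nonneg _)
            (norm_nonneg _)
      _ = n * ‖k‖ * ‖y‖ := by simp; ring
  have hseries : (fun y : Fin n → ℝ => G (fun j => (y j : UnitAddCircle))) = fun y =>
      ∑' k : Fin n → ℤ, mFourierCoeff G k * Complex.exp (2 * Real.pi * Complex.I * (L k y : ℝ)) := by
    funext y
    have := (hasSum_mFourier_series_apply_of_summable (f := ⟨G, hG⟩) hsum0
      (fun j => (y j : UnitAddCircle))).tsum_eq
    rw [ContinuousMap.coe_mk] at this
    rw [← this]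
    simp only [mFourier_coe_s13, hL, smul_eq_mul]
  have hexp (k : Fin n → ℤ) : ContDiff ℝ N fun y : Fin n → ℝ =>
      Complex.exp (2 * Real.pi * Complex.I * (L k y : ℝ)) :=
    (contDiff_const.mul (Complex.ofRealCLM.contDiff.comp (L k).contDiff)).cexp
  rw [hseries]
  refine contDiff_tsum (N := (N : ℕ∞))
    (v := fun m k => ‖mFourierCoeff G k‖ * (2 * Real.pi * (n * ‖k‖)) ^ m)
    (fun k => contDiff_const.mul (hexp k)) (fun m hm => hsum m (by exact_mod_cast hm)) ?_
  intro m k y hm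
  have hm' : m ≤ N := by exact_mod_cast hm
  have h1 := norm_iteratedFDeriv_cexp_comp_le (L k) m (2 * Real.pi * Complex.I) y
  have h2 : iteratedFDeriv ℝ m (fun y => mFourierCoeff G k *
      Complex.exp (2 * Real.pi * Complex.I * (L k y : ℝ))) y = mFourierCoeff G k •
      iteratedFDeriv ℝ m (fun y => Complex.exp (2 * Real.pi * Complex.I * (L k y : ℝ))) y :=
    iteratedFDeriv_const_smul_apply (a := mFourierCoeff G k) (((hexp k).of_le (by exact_mod_cast hm')).contDiffAt)
  rw [h2, norm_smul]
  rw [hL, ← mFourier_coe_s13, norm_mFourier_apply, mul_one] at h1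
  refine mul_le_mul_of_nonneg_left (h1.trans ?_) (norm_nonneg _)
  gcongr
  · simp [abs_of_pos Real.pi_pos]
  · exact hLn k

theorem mFourierCoeff_eq_setIntegral_Icc {n : ℕ} {F : (Fin n → ℝ) → ℂ}
    {G : UnitAddTorus (Fin n) → ℂ} (hGF : ∀ y : Fin n → ℝ, G (fun j => (y j : UnitAddCircle)) = F y)
    (k : Fin n → ℤ) :
    mFourierCoeff G k = ∫ y in Set.Icc (0 : Fin n → ℝ) 1,
        F y * Complex.exp (-2 * (Real.pi : ℂ) * Complex.I *
          ((∑ j : Fin n, (k j : ℝ) * y j : ℝ) : ℂ)) := by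
  rw [mFourierCoeff_eq_integral G k 0, volume_pi,
    ← setIntegral_congr_set (Measure.univ_pi_Ioc_ae_eq_Icc (f := (0 : Fin n → ℝ)) (g := 1))]
  have hset : {x : Fin n → ℝ | ∀ i, x i ∈ Set.Ioc ((0 : Fin n → ℝ) i) ((0 : Fin n → ℝ) i + 1)} =
      Set.univ.pi fun i => Set.Ioc ((0 : Fin n → ℝ) i) ((1 : Fin n → ℝ) i) := by
    ext x; simp
  rw [hset]
  congr 1
  funext y
  rw [hGF, mFourier_coe_s13, smul_eq_mul, mul_comm]
  congr 2
  simp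

theorem norm_fwdDiff_iter_succ_le_of_holder {f : ℝ → ℂ} {r : ℕ} (hf : ContDiff ℝ r f) {K η : ℝ}
    (hHolder : ∀ x y : ℝ, ‖iteratedDeriv r f x - iteratedDeriv r f y‖ ≤ K * |x - y| ^ η)
    (h x : ℝ) : ‖(fwdDiff h)^[r + 1] f x‖ ≤ |h| ^ r * (K * |h| ^ η) := by
  have hs : ContDiff ℝ r (fun y => f (y + h)) := hf.comp (contDiff_id.add contDiff_const)
  have hd : fwdDiff h f = (fun y => f (y + h)) - f := rfl
  rw [Function.iterate_succ_apply]
  refine norm_fwdDiff_iter_le r (hs.sub hf) (fun y => ?_) h x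
  rw [← Pi.sub_def, iteratedDeriv_sub hs.contDiffAt hf.contDiffAt, iteratedDeriv_comp_add_const]
  simpa using hHolder (y + h) y

/-- **Regularity of the parent function.** Let `p₁, …, pₙ` be `ℚ`-linearly independent
reals, `F : ℝⁿ → ℂ` continuous and `ℤⁿ`-periodic, and `f(x) = F(p₁x, …, pₙx)`.
If (a) `f ∈ C^{r,η}(ℝ)` for an integer `r > n` and `0 < η < 1`, and (b) the spectrum of
`f` satisfies the discreteness condition `|k₁p₁+⋯+kₙpₙ| ≥ D'·√(k₁²+⋯+kₙ²)` whenever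
`F̂(k) ≠ 0`, then `F` is `(r−n)`-times continuously differentiable. -/
theorem regularity_of_parent_function
    (n : ℕ) (hn : 1 ≤ n) (p : Fin n → ℝ)
    (hp : ∀ r : Fin n → ℚ, ∑ j : Fin n, (r j : ℝ) * p j = 0 → r = 0)
    (F : (Fin n → ℝ) → ℂ) (hFc : Continuous F)
    (hFper : ∀ (y : Fin n → ℝ) (k : Fin n → ℤ), F (fun j => y j + (k j : ℝ)) = F y)
    (f : ℝ → ℂ) (hf : ∀ x : ℝ, f x = F (fun j => p j * x))
    (r : ℕ) (hrn : n < r) (η : ℝ) (hη0 : 0 < η) (hη1 : η < 1)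
    (hfC : ContDiff ℝ r f)
    (K : ℝ) (hK : 0 < K)
    (hHolder : ∀ x y : ℝ,
      ‖iteratedDeriv r f x - iteratedDeriv r f y‖ ≤ K * |x - y| ^ η)
    (D' : ℝ) (hD' : 0 < D')
    (hspec : ∀ k : Fin n → ℤ,
      (∫ y in Set.Icc (0 : Fin n → ℝ) 1,
        F y * Complex.exp (-2 * (Real.pi : ℂ) * Complex.I *
          ((∑ j : Fin n, (k j : ℝ) * y j : ℝ) : ℂ))) ≠ 0 →
      D' * Real.sqrt (∑ j : Fin n, (k j : ℝ) ^ 2) ≤ |∑ j : Fin n, (k j : ℝ) * p j|) :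
    ContDiff ℝ (r - n : ℕ) F := by
  have hpZ (k : Fin n → ℤ) (hk : ∑ j, (k j : ℝ) * p j = 0) : k = 0 := by
    have := hp (fun j => (k j : ℚ)) (by simpa using hk)
    funext j
    simpa using congrFun this j
  obtain ⟨G, hG, hGF⟩ := exists_continuous_torus_lift hFc hFper
  have hFG : F = fun y => G (fun j => (y j : UnitAddCircle)) := funext fun y => (hGF y).symm
  have hfG : f = fun x => G (fun j => ((p j * x : ℝ) : UnitAddCircle)) := by
    funext x
    rw [hf, hGF fun j => p j * x]
  rw [hFG]
  refine contDiff_of_norm_mFourierCoeff_le hG (s := r + η)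
    (C := K * (2 * D')⁻¹ ^ (r + η)) ?_ ?_
  · rw [Nat.cast_sub hrn.le]
    linarith
  intro k hk
  have hkpos : 0 < ‖k‖ := norm_pos_iff.2 hk
  by_cases hc : mFourierCoeff G k = 0
  · rw [hc, norm_zero]
    positivity
  have hω := hspec k (by rwa [← mFourierCoeff_eq_setIntegral_Icc hGF])
  have hsqrt : ‖k‖ ≤ Real.sqrt (∑ j, (k j : ℝ) ^ 2) := by
    refine (pi_norm_le_iff_of_nonneg (Real.sqrt_nonneg _)).2 fun j => ?_
    rw [Int.norm_eq_abs]
    refine Real.abs_le_sqrt ?_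
    exact Finset.single_le_sum (f := fun j => (k j : ℝ) ^ 2) (fun i _ => sq_nonneg _)
      (Finset.mem_univ j)
  set ω : ℝ := ∑ j, (k j : ℝ) * p j with hωdef
  have hω' : D' * ‖k‖ ≤ |ω| := (mul_le_mul_of_nonneg_left hsqrt hD'.le).trans hω
  have hωpos : 0 < |ω| := lt_of_lt_of_le (by positivity) hω'
  have hstep : |1 / (2 * ω)| ≤ (2 * D')⁻¹ * ‖k‖⁻¹ := by
    rw [abs_div, abs_mul, abs_one, abs_two, ← mul_inv, one_div]
    exact inv_anti₀ (by positivity) (by linarith)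
  have hhpos : 0 < |1 / (2 * ω)| := by
    rw [abs_div, abs_mul, abs_one, abs_two]
    positivity
  have hdecay := norm_mFourierCoeff_le_of_fwdDiff hpZ hG hk (r + 1) fun x => by
    rw [← hfG]
    exact norm_fwdDiff_iter_succ_le_of_holder hfC hHolder _ x
  calc ‖mFourierCoeff G k‖ ≤ 2 ^ (r + 1) * ‖mFourierCoeff G k‖ :=
        le_mul_of_one_le_left (norm_nonneg _) (one_le_pow₀ one_le_two)
    _ ≤ |1 / (2 * ω)| ^ r * (K * |1 / (2 * ω)| ^ η) := hdecay
    _ = K * |1 / (2 * ω)| ^ (r + η) := by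
        rw [Real.rpow_add hhpos, Real.rpow_natCast]
        ring
    _ ≤ K * ((2 * D')⁻¹ * ‖k‖⁻¹) ^ (r + η) := by gcongr
    _ = K * (2 * D')⁻¹ ^ (r + η) * ‖k‖ ^ (-(r + η)) := by
        rw [Real.mul_rpow (by positivity) (by positivity), Real.inv_rpow hkpos.le,
          Real.rpow_neg hkpos.le]
        ring
end

section
/- Let f : ℝᵈ → ℂ be a bounded continuous function, and let C > 0 and η > 0 be constants such that for every τ ∈ ℝᵈ, limsup_{T→∞} (2T)^{-d} ∫_{[-T,T]^d} |f(x+τ) − f(x)| dx ≤ C|τ|^η. Let β ∈ ℝᵈ, β ≠ 0, be such that the Bohr–Fourier coefficient f̂(β) = lim_{T→∞} (2T)^{-d} ∫_{[-T,T]^d} f(x) e^{-2πi βᵀx} dx exists. Then |f̂(β)| ≤ (C/2) · |β|^{-η}. -/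
open MeasureTheory Filter Complex

/-- The average of a function over the cube `[-T, T]^d`. -/
noncomputable def cubeAverage {d : ℕ} (g : (Fin d → ℝ) → ℂ) (T : ℝ) : ℂ :=
  ((2 * T) ^ d)⁻¹ •
    ∫ x in Set.Icc (fun _ : Fin d => -T) (fun _ : Fin d => T), g x

lemma setIntegral_Icc_comp_add_right {ι E : Type*} [Fintype ι] [NormedAddCommGroup E]
    [NormedSpace ℝ E] (g : (ι → ℝ) → E) (a b τ : ι → ℝ) :
    ∫ x in Set.Icc a b, g (x + τ) = ∫ x in Set.Icc (a + τ) (b + τ), g x := by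
  have hpre : (fun x : ι → ℝ => x + τ) ⁻¹' Set.Icc (a + τ) (b + τ) = Set.Icc a b := by
    ext x
    simp
  rw [← hpre]
  exact (measurePreserving_add_right volume τ).setIntegral_preimage_emb
    (MeasurableEquiv.addRight τ).measurableEmbedding g _

/-- Replacing a cube by a translate that sits inside a slightly larger cube changes the integral
of a bounded function by at most the bound times the difference of the volumes. -/
lemma norm_setIntegral_cube_sub_translate_le {d : ℕ} {g : (Fin d → ℝ) → ℂ} {M : ℝ}
    (hg : Continuous g) (hM : ∀ x, ‖g x‖ ≤ M) (τ : Fin d → ℝ) {T : ℝ} (hT : 0 ≤ T) :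
    ‖(∫ x in Set.Icc (fun _ : Fin d => -(T + ‖τ‖)) (fun _ => T + ‖τ‖), g x) -
        ∫ x in Set.Icc (fun _ : Fin d => -T) (fun _ => T), g (x + τ)‖ ≤
      M * ((2 * (T + ‖τ‖)) ^ d - (2 * T) ^ d) := by
  have hA : 0 ≤ ‖τ‖ := norm_nonneg τ
  have hτ : ∀ i, |τ i| ≤ ‖τ‖ := norm_le_pi_norm τ
  rw [setIntegral_Icc_comp_add_right]
  set Q := Set.Icc (fun _ : Fin d => -(T + ‖τ‖)) (fun _ => T + ‖τ‖)
  set R := Set.Icc ((fun _ : Fin d => -T) + τ) ((fun _ => T) + τ)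
  have hRQ : R ⊆ Q := by
    refine Set.Icc_subset_Icc (fun i => ?_) (fun i => ?_)
    · have := neg_abs_le (τ i)
      have := hτ i
      simp only [Pi.add_apply]
      linarith
    · have := le_abs_self (τ i)
      have := hτ i
      simp only [Pi.add_apply]
      linarith
  have hQfin : volume Q ≠ ⊤ := isCompact_Icc.measure_lt_top.ne
  have hQ : volume.real Q = (2 * (T + ‖τ‖)) ^ d := by
    rw [measureReal_def, Real.volume_Icc_pi_toReal (fun i => by simp only; linarith)]
    simp only [Finset.prod_const, Finset.card_univ, Fintype.card_fin]
    ring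
  have hR : volume.real R = (2 * T) ^ d := by
    rw [measureReal_def, Real.volume_Icc_pi_toReal
      (fun i => by simp only [Pi.add_apply]; linarith)]
    simp only [Pi.add_apply, add_sub_add_right_eq_sub, Finset.prod_const, Finset.card_univ,
      Fintype.card_fin]
    ring
  rw [← setIntegral_sdiff measurableSet_Icc hg.continuousOn.integrableOn_Icc hRQ, ← hQ, ← hR,
    ← measureReal_sdiff hRQ measurableSet_Icc hQfin]
  exact norm_setIntegral_le_of_norm_le_const
    ((measure_mono Set.sdiff_subset).trans_lt hQfin.lt_top) (fun x _ => hM x)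

lemma tendsto_add_const_div_self_pow_atTop (A : ℝ) (d : ℕ) :
    Tendsto (fun T : ℝ => ((2 * T) ^ d)⁻¹ * (2 * (T + A)) ^ d) atTop (nhds 1) := by
  have h : Tendsto (fun T : ℝ => (1 + A * T⁻¹) ^ d) atTop (nhds 1) := by
    simpa using ((tendsto_inv_atTop_zero.const_mul A).const_add 1).pow d
  refine h.congr' ?_
  filter_upwards [eventually_gt_atTop 0] with T hT
  rw [← inv_pow, ← mul_pow]
  congr 1
  field_simp

/-- The Bohr mean of a bounded continuous function is translation invariant. -/
lemma tendsto_cubeAverage_comp_add_right {d : ℕ} {g : (Fin d → ℝ) → ℂ} {M : ℝ} {c : ℂ}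
    (hg : Continuous g) (hM : ∀ x, ‖g x‖ ≤ M) (τ : Fin d → ℝ)
    (hc : Tendsto (cubeAverage g) atTop (nhds c)) :
    Tendsto (cubeAverage fun x => g (x + τ)) atTop (nhds c) := by
  have hratio := tendsto_add_const_div_self_pow_atTop ‖τ‖ d
  have hlarge : Tendsto (fun T : ℝ => (((2 * T) ^ d)⁻¹ * (2 * (T + ‖τ‖)) ^ d) •
      cubeAverage g (T + ‖τ‖)) atTop (nhds c) := by
    simpa using hratio.smul (hc.comp (tendsto_atTop_add_const_right atTop ‖τ‖ tendsto_id))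
  have hbound : Tendsto (fun T : ℝ => M * (((2 * T) ^ d)⁻¹ * (2 * (T + ‖τ‖)) ^ d - 1))
      atTop (nhds 0) := by
    simpa using (hratio.sub_const 1).const_mul M
  have hdiff : Tendsto (fun T : ℝ => (((2 * T) ^ d)⁻¹ * (2 * (T + ‖τ‖)) ^ d) •
      cubeAverage g (T + ‖τ‖) - cubeAverage (fun x => g (x + τ)) T) atTop (nhds 0) := by
    refine squeeze_zero_norm' ?_ hbound
    filter_upwards [eventually_gt_atTop 0] with T hT
    have hA : 0 ≤ ‖τ‖ := norm_nonneg τ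
    have hpos : 0 < (2 * T) ^ d := by positivity
    have hpos' : (2 * (T + ‖τ‖)) ^ d ≠ 0 := by positivity
    rw [cubeAverage, cubeAverage, smul_smul, mul_inv_cancel_right₀ hpos', ← smul_sub, norm_smul,
      Real.norm_of_nonneg (inv_nonneg.2 hpos.le)]
    calc _ ≤ ((2 * T) ^ d)⁻¹ * (M * ((2 * (T + ‖τ‖)) ^ d - (2 * T) ^ d)) := by
          gcongr
          exact norm_setIntegral_cube_sub_translate_le hg hM τ hT.le
      _ = _ := by
          rw [mul_left_comm, mul_sub, inv_mul_cancel₀ hpos.ne']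
  simpa using hlarge.sub hdiff

lemma norm_cubeAverage_le {d : ℕ} {g h : (Fin d → ℝ) → ℂ} (hgh : ∀ x, ‖g x‖ = ‖h x‖)
    {T : ℝ} (hT : 0 ≤ T) :
    ‖cubeAverage g T‖ ≤ ((2 * T) ^ d)⁻¹ *
      ∫ x in Set.Icc (fun _ : Fin d => -T) (fun _ : Fin d => T), ‖h x‖ := by
  rw [cubeAverage, norm_smul, Real.norm_of_nonneg (by positivity)]
  gcongr
  simpa only [hgh] using norm_integral_le_integral_norm (μ := volume.restrict
    (Set.Icc (fun _ : Fin d => -T) (fun _ : Fin d => T))) g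

lemma cubeAverage_norm_le {d : ℕ} {h : (Fin d → ℝ) → ℂ} {M : ℝ} (hM : ∀ x, ‖h x‖ ≤ M)
    {T : ℝ} (hT : 0 < T) :
    ((2 * T) ^ d)⁻¹ *
      ∫ x in Set.Icc (fun _ : Fin d => -T) (fun _ : Fin d => T), ‖h x‖ ≤ M := by
  have hpos : 0 < (2 * T) ^ d := by positivity
  have hvol : volume.real (Set.Icc (fun _ : Fin d => -T) (fun _ : Fin d => T)) =
      (2 * T) ^ d := by
    rw [measureReal_def, Real.volume_Icc_pi_toReal (fun i => by simp only; linarith)]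
    simp only [Finset.prod_const, Finset.card_univ, Fintype.card_fin]
    ring
  rw [inv_mul_le_iff₀ hpos, mul_comm, ← hvol]
  refine (Real.le_norm_self _).trans ?_
  exact norm_setIntegral_le_of_norm_le_const (μ := volume) isCompact_Icc.measure_lt_top
    (fun x _ => (norm_norm (h x)).trans_le (hM x))

/-- **Decay of Bohr–Fourier coefficients from the Bohr `L¹`-modulus of continuity.**
Let `f : ℝᵈ → ℂ` be bounded and continuous, and suppose that for every `τ ∈ ℝᵈ` the
Bohr `L¹`-modulus satisfies `limsup_{T→∞} (2T)⁻ᵈ ∫_{[-T,T]^d} |f(x+τ) − f(x)| dx ≤ C|τ|^η`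
(Euclidean norm). If `β ≠ 0` and the Bohr–Fourier coefficient `f̂(β)` exists, then
`|f̂(β)| ≤ (C/2)·|β|^{-η}`. -/
theorem bohr_fourier_coeff_decay
    (d : ℕ) (hd : 1 ≤ d)
    (f : (Fin d → ℝ) → ℂ) (hfb : ∃ M : ℝ, ∀ x, ‖f x‖ ≤ M) (hfc : Continuous f)
    (C η : ℝ) (hC : 0 < C) (hη : 0 < η)
    (hmod : ∀ τ : Fin d → ℝ,
      Filter.limsup
        (fun T : ℝ => ((2 * T) ^ d)⁻¹ *
          ∫ x in Set.Icc (fun _ : Fin d => -T) (fun _ : Fin d => T), ‖f (x + τ) - f x‖)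
        atTop
        ≤ C * Real.sqrt (∑ i : Fin d, τ i ^ 2) ^ η)
    (β : Fin d → ℝ) (hβ : β ≠ 0) (cβ : ℂ)
    (hcβ : Tendsto
      (fun T : ℝ => ((2 * T) ^ d)⁻¹ •
        ∫ x in Set.Icc (fun _ : Fin d => -T) (fun _ : Fin d => T),
          f x * Complex.exp (-2 * (Real.pi : ℂ) * Complex.I *
            ((∑ i : Fin d, β i * x i : ℝ) : ℂ)))
      atTop (nhds cβ)) :
    ‖cβ‖ ≤ (C / 2) * Real.sqrt (∑ i : Fin d, β i ^ 2) ^ (-η) := by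
  obtain ⟨M, hM⟩ := hfb
  set S : ℝ := ∑ i, β i ^ 2 with hS
  have hSpos : 0 < S := by
    obtain ⟨i, hi⟩ := Function.ne_iff.1 hβ
    exact Finset.sum_pos' (fun i _ => sq_nonneg _) ⟨i, Finset.mem_univ i, by
      have : β i ≠ 0 := hi
      positivity⟩
  set e : (Fin d → ℝ) → ℂ := fun x => Complex.exp (-2 * (Real.pi : ℂ) * Complex.I *
    ((∑ i : Fin d, β i * x i : ℝ) : ℂ)) with he
  have he_cont : Continuous e := by fun_prop
  have he_norm : ∀ x, ‖e x‖ = 1 := by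
    intro x
    have : e x = Complex.exp (((-2 * Real.pi * ∑ i : Fin d, β i * x i : ℝ) : ℂ) * Complex.I) := by
      simp only [he]
      congr 1
      push_cast
      ring
    rw [this, Complex.norm_exp_ofReal_mul_I]
  -- translating by half a period flips the sign of the character
  set τ : Fin d → ℝ := fun i => β i / (2 * S) with hτ
  have he_shift : ∀ x, e (x + τ) = -e x := by
    intro x
    have hsum : ∑ i, β i * (x + τ) i = ∑ i, β i * x i + 1 / 2 := by
      have : ∑ i, β i * τ i = 1 / 2 := by
        calc ∑ i, β i * τ i = (∑ i, β i ^ 2) / (2 * S) := by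
              rw [Finset.sum_div]
              exact Finset.sum_congr rfl fun i _ => by simp only [hτ]; ring
          _ = 1 / 2 := by rw [← hS]; field_simp
      simp only [Pi.add_apply, mul_add, Finset.sum_add_distrib, this]
    simp only [he, hsum]
    rw [← Complex.exp_sub_pi_mul_I]
    congr 1
    push_cast
    ring
  have hτ_norm : Real.sqrt (∑ i, τ i ^ 2) = (2 * Real.sqrt S)⁻¹ := by
    have : ∑ i, τ i ^ 2 = ((2 * Real.sqrt S)⁻¹) ^ 2 := by
      calc ∑ i, τ i ^ 2 = (∑ i, β i ^ 2) / (2 * S) ^ 2 := by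
            rw [Finset.sum_div]
            exact Finset.sum_congr rfl fun i _ => by simp only [hτ, div_pow]
        _ = _ := by
            rw [← hS, inv_pow, mul_pow, mul_pow, Real.sq_sqrt hSpos.le]
            field_simp
    rw [this, Real.sqrt_sq (by positivity)]
  have hc : Tendsto (cubeAverage fun x => f x * e x) atTop (nhds cβ) := hcβ
  have hc_shift := tendsto_cubeAverage_comp_add_right (M := M) (hfc.mul he_cont)
    (fun x => by simpa [he_norm] using hM x) τ hc
  have hsplit : ∀ T, cubeAverage (fun x => (f (x + τ) - f x) * e x) T =
      -(cubeAverage (fun x => f (x + τ) * e (x + τ)) T + cubeAverage (fun x => f x * e x) T) := by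
    intro T
    have h₁ : Continuous fun x => f (x + τ) * e (x + τ) := by fun_prop
    have h₂ : Continuous fun x => f x * e x := by fun_prop
    rw [cubeAverage, cubeAverage, cubeAverage, ← smul_add, ← smul_neg,
      ← integral_add h₁.continuousOn.integrableOn_Icc h₂.continuousOn.integrableOn_Icc,
      ← integral_neg]
    congr 2
    funext x
    rw [he_shift]
    ring
  have hlim : Tendsto (fun T => ‖cubeAverage (fun x => (f (x + τ) - f x) * e x) T‖) atTop
      (nhds (2 * ‖cβ‖)) := by
    have := (hc_shift.add hc).neg.norm
    rw [norm_neg, ← two_mul, norm_mul, Complex.norm_ofNat] at this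
    exact this.congr fun T => by rw [hsplit]; rfl
  have hbdd : ∀ x, ‖f (x + τ) - f x‖ ≤ M + M := fun x =>
    (norm_sub_le _ _).trans (add_le_add (hM _) (hM _))
  have hle : 2 * ‖cβ‖ ≤ C * Real.sqrt (∑ i, τ i ^ 2) ^ η := by
    rw [← hlim.limsup_eq]
    refine (limsup_le_limsup ?_ hlim.isCoboundedUnder_le ?_).trans (hmod τ)
    · filter_upwards [eventually_ge_atTop 0] with T hT
      exact norm_cubeAverage_le (fun x => by rw [norm_mul, he_norm, mul_one]) hT
    · refine isBoundedUnder_of_eventually_le (a := M + M) ?_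
      filter_upwards [eventually_gt_atTop 0] with T hT
      exact cubeAverage_norm_le hbdd hT
  have hpow : Real.sqrt (∑ i, τ i ^ 2) ^ η ≤ Real.sqrt S ^ (-η) := by
    have hs : 0 < Real.sqrt S := Real.sqrt_pos.2 hSpos
    rw [hτ_norm, Real.rpow_neg hs.le, ← Real.inv_rpow hs.le]
    gcongr
    linarith
  have := mul_le_mul_of_nonneg_left hpow hC.le
  linarith
end

section
/- Let F : ℝⁿ → ℂ be continuous and ℤⁿ-periodic, let P be a d×n real matrix, let 1 < q < ∞ with conjugate exponent q' = q/(q−1), and let s > 0 satisfy s − n/q > 1. Suppose: (i) ∑_{k ∈ ℤⁿ} (1 + |Pk|²)^{s q'/2} |F̂(k)|^{q'} < ∞ (the Sobolev–Besicovitch condition on the quasi-periodic function f(x) = F(Pᵀx)); (ii) there is a constant c > 0 such that |Pk| ≥ c|k| for every k ∈ ℤⁿ with F̂(k) ≠ 0. Then for every integer m with 0 ≤ m < s − n/q, the function F is m-times continuously differentiable; in particular ∑_{k∈ℤⁿ} |k|^m |F̂(k)| < ∞. -/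
open MeasureTheory Complex

/-- The series `∑ k ∈ ℤⁿ, ‖k‖ ^ r`, with the sup norm, converges for `r < -n`. -/
lemma summable_intCast_pi_norm_rpow (n : ℕ) (r : ℝ) (hr : r < -n) :
    Summable fun k : Fin n → ℤ => ‖fun j => (k j : ℝ)‖ ^ r := by
  obtain ⟨L, hdisc, hfin, hmem⟩ : ∃ L : Submodule ℤ (Fin n → ℝ), DiscreteTopology L ∧
      Module.finrank ℤ L = n ∧ ∀ k : Fin n → ℤ, (fun j => (k j : ℝ)) ∈ L := by
    refine ⟨Submodule.span ℤ (Set.range (Pi.basisFun ℝ (Fin n))), inferInstance, ?_, fun k => ?_⟩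
    · rw [ZLattice.rank ℝ, Module.finrank_fin_fun]
    · exact ((Pi.basisFun ℝ (Fin n)).mem_span_iff_repr_mem ℤ _).2 fun i => ⟨k i, by simp⟩
  have hL : Summable fun z : L => ‖z‖ ^ r := ZLattice.summable_norm_rpow L r (by rwa [hfin])
  have hinj : Function.Injective fun k : Fin n → ℤ => (⟨fun j => (k j : ℝ), hmem k⟩ : L) :=
      fun k l h => by
    funext j
    exact Int.cast_injective (congrFun (Subtype.mk.inj h) j)
  exact (hL.comp_injective hinj).congr fun k => by
    simp only [Function.comp_apply, Submodule.coe_norm]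

/-- The series `∑ k ∈ ℤⁿ, (1 + |k|) ^ r` converges for `r < -n`. -/
lemma summable_one_add_euclidean_rpow (n : ℕ) (r : ℝ) (hr : r < -n) :
    Summable fun k : Fin n → ℤ => (1 + √(∑ j, (k j : ℝ) ^ 2)) ^ r := by
  have hsum := summable_intCast_pi_norm_rpow n r hr
  have hsum' := hsum.add ((hasSum_ite_eq (0 : Fin n → ℤ) (1 : ℝ)).summable)
  refine Summable.of_nonneg_of_le (fun k => by positivity) (fun k => ?_) hsum'
  have hr0 : r ≤ 0 := hr.le.trans (by simp)
  by_cases hk : k = 0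
  · subst hk
    simp only [Pi.zero_apply, Int.cast_zero, if_true]
    have : (0 : ℝ) ≤ ‖fun _ : Fin n => (0 : ℝ)‖ ^ r := by positivity
    simpa using this
  · rw [if_neg hk, add_zero]
    have hne : (fun j => (k j : ℝ)) ≠ 0 := fun h => hk <| by
      funext j
      exact Int.cast_eq_zero.1 (congrFun h j)
    refine Real.rpow_le_rpow_of_nonpos (norm_pos_iff.2 hne) ?_ hr0
    refine (pi_norm_le_iff_of_nonneg (by positivity)).2 fun j => ?_
    have : |(k j : ℝ)| ≤ √(∑ j, (k j : ℝ) ^ 2) :=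
      Real.abs_le_sqrt (Finset.single_le_sum (f := fun j => (k j : ℝ) ^ 2)
        (fun i _ => sq_nonneg _) (Finset.mem_univ j))
    rw [Real.norm_eq_abs]
    linarith

/-- If `W k` dominates `(1 + |k|) ^ 2` on the support of `a` up to a constant, a weighted
`ℓ^{q'}` bound on `a` gives weighted `ℓ¹` bounds by Hölder's inequality. -/
lemma summable_pow_mul_norm_of_summable_rpow {n : ℕ} {q s C : ℝ} (hq : 1 < q) (hs : 0 ≤ s)
    (hC : 0 < C) {a : (Fin n → ℤ) → ℂ} {W : (Fin n → ℤ) → ℝ} (hW : ∀ k, 0 ≤ W k)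
    (hsum : Summable fun k => W k ^ (s * (q / (q - 1)) / 2) * ‖a k‖ ^ (q / (q - 1)))
    (hle : ∀ k, a k ≠ 0 → C * (1 + √(∑ j, (k j : ℝ) ^ 2)) ^ 2 ≤ W k)
    (m : ℕ) (hm : (m : ℝ) < s - n / q) :
    Summable fun k : Fin n → ℤ => √(∑ j, (k j : ℝ) ^ 2) ^ m * ‖a k‖ := by
  have hq0 : 0 < q := by linarith
  have hpq : (q / (q - 1)).HolderConjugate q := (Real.HolderConjugate.conjExponent hq).symm
  have hg : Summable fun k : Fin n → ℤ =>
      ((1 + √(∑ j, (k j : ℝ) ^ 2)) ^ ((m : ℝ) - s)) ^ q := by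
    have hr : ((m : ℝ) - s) * q < -n := by
      have : n / q * q = (n : ℝ) := div_mul_cancel₀ _ hq0.ne'
      nlinarith
    refine (summable_one_add_euclidean_rpow n _ hr).congr fun k => ?_
    rw [← Real.rpow_mul (by positivity)]
  have hf : Summable fun k => (W k ^ (s / 2) * ‖a k‖) ^ (q / (q - 1)) := by
    refine hsum.congr fun k => ?_
    rw [Real.mul_rpow (Real.rpow_nonneg (hW k) _) (norm_nonneg _), ← Real.rpow_mul (hW k)]
    ring_nf
  have hprod := (Real.summable_mul_of_Lp_Lq_of_nonneg hpq
    (fun k => mul_nonneg (Real.rpow_nonneg (hW k) _) (norm_nonneg _))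
    (fun k => by positivity) hf hg).mul_left (C ^ (s / 2))⁻¹
  refine Summable.of_nonneg_of_le (fun k => by positivity) (fun k => ?_) hprod
  by_cases hk : a k = 0
  · simp [hk]
  set E := √(∑ j, (k j : ℝ) ^ 2)
  have hE : 0 ≤ E := Real.sqrt_nonneg _
  have h1 : C ^ (s / 2) * (1 + E) ^ s ≤ W k ^ (s / 2) := by
    have h := Real.rpow_le_rpow (by positivity) (hle k hk) (by linarith : 0 ≤ s / 2)
    rw [Real.mul_rpow hC.le (by positivity), ← Real.rpow_natCast, ← Real.rpow_mul (by positivity)]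
      at h
    convert h using 3
    push_cast
    ring
  have h2 : (1 + E) ^ s * (1 + E) ^ ((m : ℝ) - s) = (1 + E) ^ m := by
    rw [← Real.rpow_add (by positivity), ← Real.rpow_natCast]
    ring_nf
  have hCs : 0 < C ^ (s / 2) := by positivity
  calc E ^ m * ‖a k‖ ≤ (1 + E) ^ m * ‖a k‖ := by gcongr; linarith
    _ = (C ^ (s / 2))⁻¹ * (C ^ (s / 2) * (1 + E) ^ s * ‖a k‖ * (1 + E) ^ ((m : ℝ) - s)) := by
        rw [← h2]
        field_simp
    _ ≤ _ := by gcongr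

/-- The derivatives of a plane wave are bounded by powers of its frequency. -/
lemma norm_iteratedFDeriv_cexp_clm_le {E : Type*} [NormedAddCommGroup E] [NormedSpace ℝ E]
    (l : E →L[ℝ] ℝ) (i : ℕ) (x : E) :
    ‖iteratedFDeriv ℝ i (fun y => cexp (I * (l y : ℂ))) x‖ ≤ ‖l‖ ^ i := by
  have hcd : ContDiff ℝ ⊤ fun t : ℝ => cexp (I * (t : ℂ)) :=
    (contDiff_const.mul ofRealCLM.contDiff).cexp
  have hder : ∀ i : ℕ, iteratedDeriv i (fun t : ℝ => cexp (I * (t : ℂ))) =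
      fun t : ℝ => I ^ i * cexp (I * (t : ℂ)) := by
    intro i
    induction i with
    | zero => simp
    | succ i ih =>
      rw [iteratedDeriv_succ, ih]
      funext t
      have h : HasDerivAt (fun t : ℝ => I ^ i * cexp (I * (t : ℂ)))
          (I ^ i * (cexp (I * (t : ℂ)) * (I * 1))) t :=
        ((((hasDerivAt_id (t : ℂ)).comp_ofReal).const_mul I).cexp).const_mul _
      rw [h.deriv]
      ring
  have h := l.iteratedFDeriv_comp_right (hcd.of_le le_top) x (i := i) (n := i) le_rfl
  have h' : (fun t : ℝ => cexp (I * (t : ℂ))) ∘ l = fun y => cexp (I * (l y : ℂ)) := rfl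
  rw [h'] at h
  rw [h]
  refine (ContinuousMultilinearMap.norm_compContinuousLinearMap_le _ _).trans ?_
  rw [norm_iteratedFDeriv_eq_norm_iteratedDeriv, hder]
  simp [mul_comm I, Complex.norm_exp_ofReal_mul_I]

/-- A trigonometric series is of class `C^m` if the coefficients times `|k| ^ i` are absolutely
summable for all `i ≤ m`. -/
lemma contDiff_tsum_trigonometric {n m : ℕ} {a : (Fin n → ℤ) → ℂ}
    (ha : ∀ i ≤ m, Summable fun k : Fin n → ℤ => √(∑ j, (k j : ℝ) ^ 2) ^ i * ‖a k‖) :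
    ContDiff ℝ m fun y : Fin n → ℝ =>
      ∑' k, a k * cexp (2 * Real.pi * I * ((∑ j, (k j : ℝ) * y j : ℝ) : ℂ)) := by
  let l : (Fin n → ℤ) → (Fin n → ℝ) →L[ℝ] ℝ := fun k =>
    ∑ j, (2 * Real.pi * k j) • ContinuousLinearMap.proj (R := ℝ) (φ := fun _ => ℝ) j
  have hl : ∀ k y, cexp (2 * Real.pi * I * ((∑ j, (k j : ℝ) * y j : ℝ) : ℂ)) =
      cexp (I * (l k y : ℂ)) := fun k y => by
    have : l k y = 2 * Real.pi * ∑ j, (k j : ℝ) * y j := by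
      simp [l, Finset.mul_sum, mul_assoc]
    rw [this]
    push_cast
    ring_nf
  have hnorm : ∀ k, ‖l k‖ ≤ 2 * Real.pi * n * √(∑ j, (k j : ℝ) ^ 2) := fun k => by
    refine ContinuousLinearMap.opNorm_le_bound _ (by positivity) fun y => ?_
    have : l k y = ∑ j, 2 * Real.pi * (k j : ℝ) * y j := by
      simp [l]
    rw [this]
    refine (norm_sum_le _ _).trans ?_
    calc _ ≤ ∑ _j : Fin n, 2 * Real.pi * √(∑ j, (k j : ℝ) ^ 2) * ‖y‖ := by
          refine Finset.sum_le_sum fun j _ => ?_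
          rw [norm_mul, norm_mul, Real.norm_of_nonneg (by positivity : 0 ≤ 2 * Real.pi)]
          gcongr
          · exact Real.abs_le_sqrt (Finset.single_le_sum (f := fun j => (k j : ℝ) ^ 2)
              (fun i _ => sq_nonneg _) (Finset.mem_univ j))
          · exact norm_le_pi_norm y j
      _ = _ := by simp; ring
  simp_rw [hl]
  have hcd : ∀ k, ContDiff ℝ (m : ℕ∞) fun y => cexp (I * (l k y : ℂ)) := fun k =>
    (contDiff_const.mul (ofRealCLM.contDiff.comp (l k).contDiff)).cexp
  refine contDiff_tsum (N := (m : ℕ∞))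
    (v := fun i k => (2 * Real.pi * n) ^ i * (√(∑ j, (k j : ℝ) ^ 2) ^ i * ‖a k‖))
    (fun k => contDiff_const.mul (hcd k)) (fun i hi => (ha i (by exact_mod_cast hi)).mul_left _)
    fun i k x hi => ?_
  have hsm : iteratedFDeriv ℝ i (fun y => a k * cexp (I * (l k y : ℂ))) x =
      a k • iteratedFDeriv ℝ i (fun y => cexp (I * (l k y : ℂ))) x :=
    iteratedFDeriv_const_smul_apply' (a := a k) (((hcd k).of_le (by exact_mod_cast hi)).contDiffAt)
  rw [hsm, norm_smul, ← mul_assoc, ← mul_pow, mul_comm]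
  gcongr
  exact (norm_iteratedFDeriv_cexp_clm_le _ _ _).trans (by gcongr; exact hnorm k)

/-- A continuous `ℤⁿ`-periodic function with absolutely summable Fourier coefficients is the sum
of its Fourier series. -/
lemma eq_tsum_fourier_of_periodic {n : ℕ} {F : (Fin n → ℝ) → ℂ} (hFc : Continuous F)
    (hFper : ∀ (y : Fin n → ℝ) (k : Fin n → ℤ), F (fun j => y j + (k j : ℝ)) = F y)
    {a : (Fin n → ℤ) → ℂ}
    (ha : ∀ k : Fin n → ℤ, a k = ∫ y in Set.Icc (0 : Fin n → ℝ) 1,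
      F y * cexp (-2 * (Real.pi : ℂ) * I * ((∑ j, (k j : ℝ) * y j : ℝ) : ℂ)))
    (hsum : Summable a) :
    F = fun y => ∑' k, a k * cexp (2 * Real.pi * I * ((∑ j, (k j : ℝ) * y j : ℝ) : ℂ)) := by
  let p : C(Fin n → ℝ, UnitAddTorus (Fin n)) := ⟨fun y j => (y j : UnitAddCircle), by fun_prop⟩
  have hp : Topology.IsQuotientMap p :=
    (IsOpenQuotientMap.piMap (f := fun (_ : Fin n) (t : ℝ) => (t : UnitAddCircle))
      fun _ => QuotientAddGroup.isOpenQuotientMap_mk).isQuotientMap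
  have hfac : ∀ x y, p x = p y → F x = F y := fun x y h => by
    have h1 : ∀ j, ∃ k : ℤ, x j = y j + k := fun j => by
      have h2 : ((x j - y j : ℝ) : UnitAddCircle) = 0 := by
        rw [AddCircle.coe_sub, sub_eq_zero]
        exact congrFun h j
      obtain ⟨k, hk⟩ := (AddCircle.coe_eq_zero_iff (1 : ℝ)).1 h2
      refine ⟨k, ?_⟩
      simp only [zsmul_eq_mul, mul_one] at hk
      linarith
    choose k hk using h1
    rw [← hFper y k]
    exact congrArg F (funext hk)
  let f : C(UnitAddTorus (Fin n), ℂ) := hp.lift ⟨F, hFc⟩ hfac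
  have hf : ∀ y, f (fun j => (y j : UnitAddCircle)) = F y := fun y =>
    congrArg (fun g : C(Fin n → ℝ, ℂ) => g y) (hp.lift_comp ⟨F, hFc⟩ hfac)
  have hmon : ∀ (k : Fin n → ℤ) (y : Fin n → ℝ),
      UnitAddTorus.mFourier k (fun j => (y j : UnitAddCircle)) =
        cexp (2 * Real.pi * I * ((∑ j, (k j : ℝ) * y j : ℝ) : ℂ)) := fun k y => by
    simp only [UnitAddTorus.mFourier, ContinuousMap.coe_mk, fourier_coe_apply]
    rw [← Complex.exp_sum]
    push_cast
    rw [Finset.mul_sum]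
    congr 1
    exact Finset.sum_congr rfl fun j _ => by ring
  have hcoeff : UnitAddTorus.mFourierCoeff f = a := by
    funext k
    have hset : {x : Fin n → ℝ | ∀ i, x i ∈ Set.Ioc ((0 : Fin n → ℝ) i) ((0 : Fin n → ℝ) i + 1)}
        = Set.univ.pi fun i => Set.Ioc ((0 : Fin n → ℝ) i) ((1 : Fin n → ℝ) i) := by
      ext x; simp
    rw [UnitAddTorus.mFourierCoeff_eq_integral _ _ 0, hset, ha,
      setIntegral_congr_set (μ := volume) (Measure.univ_pi_Ioc_ae_eq_Icc (μ := fun _ => volume))]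
    congr 1
    funext y
    rw [hmon, hf, smul_eq_mul, mul_comm]
    congr 2
    simp
  funext y
  have h := UnitAddTorus.hasSum_mFourier_series_apply_of_summable (f := f) (by rwa [hcoeff])
    (fun j => (y j : UnitAddCircle))
  rw [hcoeff, hf] at h
  simp_rw [hmon, smul_eq_mul] at h
  exact h.tsum_eq.symm

/-- **Sobolev–Besicovitch regularity of the parent function.**
Let `F : ℝⁿ → ℂ` be continuous and `ℤⁿ`-periodic, `P` a `d × n` real matrix,
`1 < q < ∞` with conjugate exponent `q' = q/(q−1)`, and `s` with `s − n/q > 1`.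
Suppose (i) `∑_k (1 + |Pk|²)^{sq'/2} |F̂(k)|^{q'} < ∞`, and (ii) there is `c > 0` with
`|Pk| ≥ c|k|` whenever `F̂(k) ≠ 0` (Euclidean norms). Then for every integer `m` with
`m < s − n/q`, `F` is `m`-times continuously differentiable, and in particular
`∑_k |k|^m |F̂(k)| < ∞`. -/
theorem sobolev_besicovitch_regularity_parent
    (d n : ℕ) (hd : 1 ≤ d) (hn : 1 ≤ n)
    (F : (Fin n → ℝ) → ℂ) (hFc : Continuous F)
    (hFper : ∀ (y : Fin n → ℝ) (k : Fin n → ℤ), F (fun j => y j + (k j : ℝ)) = F y)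
    (P : Matrix (Fin d) (Fin n) ℝ)
    (q s : ℝ) (hq : 1 < q) (hs : 1 < s - (n : ℝ) / q)
    (Fhat : (Fin n → ℤ) → ℂ)
    (hFhat : ∀ k : Fin n → ℤ,
      Fhat k = ∫ y in Set.Icc (0 : Fin n → ℝ) 1,
        F y * Complex.exp (-2 * (Real.pi : ℂ) * Complex.I *
          ((∑ j : Fin n, (k j : ℝ) * y j : ℝ) : ℂ)))
    (hi : Summable (fun k : Fin n → ℤ =>
      (1 + Real.sqrt (∑ i : Fin d, (∑ j : Fin n, P i j * (k j : ℝ)) ^ 2) ^ 2)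
          ^ (s * (q / (q - 1)) / 2) *
        ‖Fhat k‖ ^ (q / (q - 1))))
    (c : ℝ) (hc : 0 < c)
    (hii : ∀ k : Fin n → ℤ, Fhat k ≠ 0 →
      c * Real.sqrt (∑ j : Fin n, (k j : ℝ) ^ 2) ≤
        Real.sqrt (∑ i : Fin d, (∑ j : Fin n, P i j * (k j : ℝ)) ^ 2)) :
    ∀ m : ℕ, (m : ℝ) < s - (n : ℝ) / q →
      ContDiff ℝ m F ∧
      Summable (fun k : Fin n → ℤ =>
        Real.sqrt (∑ j : Fin n, (k j : ℝ) ^ 2) ^ m * ‖Fhat k‖) := by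
  have hq0 : 0 < q := by linarith
  have hnq : 0 ≤ (n : ℝ) / q := by positivity
  have hmin : 0 < min 1 (c ^ 2) := lt_min one_pos (by positivity)
  have key : ∀ m : ℕ, (m : ℝ) < s - (n : ℝ) / q → Summable (fun k : Fin n → ℤ =>
      Real.sqrt (∑ j : Fin n, (k j : ℝ) ^ 2) ^ m * ‖Fhat k‖) := by
    refine summable_pow_mul_norm_of_summable_rpow hq (by linarith) (half_pos hmin)
      (fun k => by positivity) hi fun k hk => ?_
    have h := pow_le_pow_left₀ (by positivity) (hii k hk) 2
    set E := Real.sqrt (∑ j : Fin n, (k j : ℝ) ^ 2)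
    have h1 := min_le_left 1 (c ^ 2)
    have h2 := min_le_right 1 (c ^ 2)
    nlinarith [mul_nonneg hmin.le (sq_nonneg (1 - E)), mul_nonneg (sub_nonneg.2 h2) (sq_nonneg E)]
  intro m hm
  refine ⟨?_, key m hm⟩
  have hsum : Summable Fhat := Summable.of_norm <| by simpa using key 0 (by push_cast; linarith)
  rw [eq_tsum_fourier_of_periodic hFc hFper hFhat hsum]
  exact contDiff_tsum_trigonometric fun i hi' =>
    key i (lt_of_le_of_lt (by exact_mod_cast hi') hm)
end
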